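/- arXiv:2201.07579 — 2 statements merged into one kernel-verified Lean document; each statement's English description precedes it below -/
import Mathlib

section
/- Let C ⊆ F_q^{n×m} (n ≤ m) be a dually qOAC with dim(C) = αm + ρ, 0 < ρ < m (so 0 ≤ α < n). Then one of the following holds: (a) C is equivalent to the code of all matrices whose first α rows are arbitrary, whose row α+1 is arbitrary in the first ρ entries and zero in the last m−ρ entries, and whose remaining n−α−1 rows are zero; (b) ρ ≤ n−α and C is equivalent to the code of all matrices whose first α rows are arbitrary, whose rows α+1,…,α+ρ are arbitrary in the first entry and zero elsewhere, and whose remaining rows are zero; (c) ρ ≥ m−α−1 and C is equivalent to the code of all matrices whose first α+ρ+1−m rows are arbitrary, whose rows α+ρ+2−m,…,α+1 are arbitrary in the first m−1 entries and zero in the last entry, and whose remaining n−α−1 rows are zero; (d) m = n+1, ρ = n−α, and C is equivalent to the code of all matrices whose first α+1 columns are arbitrary and whose last n−α columns are zero. -/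
open Matrix

/-- The maximum rank of a rank-metric code (an `𝔽`-linear subspace of `n × m` matrices). -/
noncomputable def maxrk {𝔽 : Type*} [Field 𝔽] {n m : ℕ}
    (C : Submodule 𝔽 (Matrix (Fin n) (Fin m) 𝔽)) : ℕ :=
  sSup (Matrix.rank '' (C : Set (Matrix (Fin n) (Fin m) 𝔽)))

/-- The dual code with respect to the trace bilinear form `⟨M, N⟩ = Tr(M Nᵗ)`. -/
def dualCode {𝔽 : Type*} [Field 𝔽] {n m : ℕ}
    (C : Submodule 𝔽 (Matrix (Fin n) (Fin m) 𝔽)) :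
    Submodule 𝔽 (Matrix (Fin n) (Fin m) 𝔽) where
  carrier := {M | ∀ N ∈ C, Matrix.trace (M * Nᵀ) = 0}
  add_mem' := by
    intro a b ha hb N hN
    show Matrix.trace ((a + b) * Nᵀ) = 0
    rw [Matrix.add_mul, Matrix.trace_add, ha N hN, hb N hN, add_zero]
  zero_mem' := by
    intro N hN
    simp
  smul_mem' := by
    intro c a ha N hN
    show Matrix.trace ((c • a) * Nᵀ) = 0
    rw [Matrix.smul_mul, Matrix.trace_smul, ha N hN, smul_zero]

/-- `C` is an optimal anticode if `dim C = m * maxrk C`. -/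
def isOptAnticode {𝔽 : Type*} [Field 𝔽] {n m : ℕ}
    (C : Submodule 𝔽 (Matrix (Fin n) (Fin m) 𝔽)) : Prop :=
  Module.finrank 𝔽 C = m * maxrk C

/-- `C` is a quasi optimal anticode if `m ∤ dim C` and `maxrk C = ⌈dim C / m⌉`. -/
def isQOAC {𝔽 : Type*} [Field 𝔽] {n m : ℕ}
    (C : Submodule 𝔽 (Matrix (Fin n) (Fin m) 𝔽)) : Prop :=
  ¬ (m ∣ Module.finrank 𝔽 C) ∧
    (maxrk C : ℤ) = ⌈(Module.finrank 𝔽 C : ℚ) / (m : ℚ)⌉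

/-- `C` is a dually quasi optimal anticode if both `C` and `C^⊥` are qOACs. -/
def isDuallyQOAC {𝔽 : Type*} [Field 𝔽] {n m : ℕ}
    (C : Submodule 𝔽 (Matrix (Fin n) (Fin m) 𝔽)) : Prop :=
  isQOAC C ∧ isQOAC (dualCode C)

/-- The code of matrices vanishing at all positions `(i, j)` with `¬ P i j`. -/
def zeroOutside {𝔽 : Type*} [Field 𝔽] {n m : ℕ} (P : Fin n → Fin m → Prop) :
    Submodule 𝔽 (Matrix (Fin n) (Fin m) 𝔽) where
  carrier := {M | ∀ i j, ¬ P i j → M i j = 0}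
  add_mem' := by
    intro a b ha hb i j h
    simp [Matrix.add_apply, ha i j h, hb i j h]
  zero_mem' := by
    intro i j h
    simp
  smul_mem' := by
    intro c a ha i j h
    simp [Matrix.smul_apply, ha i j h]

/-- `Mat(V)`: the matrices all of whose columns lie in `V ⊆ 𝔽^n`. -/
def matCol {𝔽 : Type*} [Field 𝔽] {n m : ℕ} (V : Submodule 𝔽 (Fin n → 𝔽)) :
    Submodule 𝔽 (Matrix (Fin n) (Fin m) 𝔽) where
  carrier := {M | ∀ j, (fun i => M i j) ∈ V}
  add_mem' := by
    intro a b ha hb j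
    exact V.add_mem (ha j) (hb j)
  zero_mem' := by
    intro j
    exact V.zero_mem
  smul_mem' := by
    intro c a ha j
    exact V.smul_mem c (ha j)

/-- `Mat(U)ᵗ`: the matrices all of whose rows lie in `U ⊆ 𝔽^m`. -/
def matRow {𝔽 : Type*} [Field 𝔽] {n m : ℕ} (U : Submodule 𝔽 (Fin m → 𝔽)) :
    Submodule 𝔽 (Matrix (Fin n) (Fin m) 𝔽) where
  carrier := {M | ∀ i, M i ∈ U}
  add_mem' := by
    intro a b ha hb i
    exact U.add_mem (ha i) (hb i)
  zero_mem' := by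
    intro i
    exact U.zero_mem
  smul_mem' := by
    intro c a ha i
    exact U.smul_mem c (ha i)

/-- `⟨e_1, …, e_s⟩ ⊆ 𝔽^ℓ`: the span of the first `s` canonical basis vectors. -/
def spanFirst (𝔽 : Type*) [Field 𝔽] (ℓ s : ℕ) : Submodule 𝔽 (Fin ℓ → 𝔽) :=
  Submodule.span 𝔽 ((fun i : Fin ℓ => Pi.single i (1 : 𝔽)) '' {i : Fin ℓ | (i : ℕ) < s})

/-- Orthogonal complement with respect to the standard dot product on `𝔽^ℓ`. -/
def perp {𝔽 : Type*} [Field 𝔽] {ℓ : ℕ} (W : Submodule 𝔽 (Fin ℓ → 𝔽)) :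
    Submodule 𝔽 (Fin ℓ → 𝔽) where
  carrier := {v | ∀ w ∈ W, ∑ i, v i * w i = 0}
  add_mem' := by
    intro a b ha hb w hw
    simp [add_mul, Finset.sum_add_distrib, ha w hw, hb w hw]
  zero_mem' := by
    intro w hw
    simp
  smul_mem' := by
    intro c a ha w hw
    simp [mul_assoc, ← Finset.mul_sum, ha w hw]

/-- Equivalence of rank-metric codes: `C = {N A M : A ∈ D}` for invertible `N, M`, or
(when `n = m`) `C = {N Aᵗ M : A ∈ D}` for invertible `N, M`. -/
def equivCode {𝔽 : Type*} [Field 𝔽] {n m : ℕ}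
    (C D : Submodule 𝔽 (Matrix (Fin n) (Fin m) 𝔽)) : Prop :=
  (∃ (N : Matrix (Fin n) (Fin n) 𝔽) (M : Matrix (Fin m) (Fin m) 𝔽),
      IsUnit N ∧ IsUnit M ∧
      (C : Set (Matrix (Fin n) (Fin m) 𝔽)) = (fun A : Matrix (Fin n) (Fin m) 𝔽 => N * A * M) '' (D : Set (Matrix (Fin n) (Fin m) 𝔽))) ∨
  (∃ (h : n = m) (N : Matrix (Fin n) (Fin n) 𝔽) (M : Matrix (Fin m) (Fin m) 𝔽),
      IsUnit N ∧ IsUnit M ∧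
      (C : Set (Matrix (Fin n) (Fin m) 𝔽)) =
        (fun A : Matrix (Fin n) (Fin m) 𝔽 =>
          N * (Matrix.reindex (finCongr h.symm) (finCongr h) Aᵀ) * M) ''
          (D : Set (Matrix (Fin n) (Fin m) 𝔽)))

/-- The Gaussian `q`-binomial coefficient, as a rational number. -/
def gaussBinom (q a r : ℕ) : ℚ :=
  (∏ i ∈ Finset.range r, ((q : ℚ) ^ a - (q : ℚ) ^ i)) /
    (∏ i ∈ Finset.range r, ((q : ℚ) ^ r - (q : ℚ) ^ i))

/-- `φ_q(a, b, r)`: the number of rank-`r` matrices in `𝔽_q^{a×b}`. -/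
def phiq (q a b r : ℕ) : ℚ :=
  gaussBinom q a r * ∏ i ∈ Finset.range r, ((q : ℚ) ^ b - (q : ℚ) ^ i)

theorem linearIndependent_cons_of_mkQ {K V : Type*} [Field K] [AddCommGroup V] [Module K V]
    {l : ℕ} {x : V} (hx : x ≠ 0) (p : Fin l → V)
    (h : LinearIndependent K fun i => (K ∙ x).mkQ (p i)) :
    LinearIndependent K (Fin.cons x p : Fin (l + 1) → V) := by
  rw [linearIndependent_finCons]
  refine ⟨LinearIndependent.of_comp (K ∙ x).mkQ h, fun hmem => hx ?_⟩
  obtain ⟨c, hc⟩ := (Submodule.mem_span_range_iff_exists_fun K).1 hmem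
  have h0 : (K ∙ x).mkQ x = 0 := by simp [Submodule.mem_span_singleton_self]
  have h1 : ∑ i, c i • (K ∙ x).mkQ (p i) = 0 := by
    have h2 := congrArg (K ∙ x).mkQ hc
    rw [h0] at h2
    simpa only [map_sum, map_smul] using h2
  have hc0 := Fintype.linearIndependent_iff.1 h c h1
  simp [← hc, hc0]

open Module in
theorem finrank_comap_mkQ_span_singleton_le {K V : Type*} [Field K] [AddCommGroup V] [Module K V]
    [FiniteDimensional K V] (x : V) (S : Submodule K (V ⧸ (K ∙ x))) :
    finrank K (S.comap (K ∙ x).mkQ) ≤ finrank K S + 1 := by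
  have h := LinearMap.finrank_range_add_finrank_ker
    ((K ∙ x).mkQ.domRestrict (S.comap (K ∙ x).mkQ))
  have h1 : finrank K (LinearMap.range ((K ∙ x).mkQ.domRestrict (S.comap (K ∙ x).mkQ)))
      ≤ finrank K S := by
    apply Submodule.finrank_mono
    rintro _ ⟨y, rfl⟩
    exact y.2
  have h2 : finrank K (LinearMap.ker ((K ∙ x).mkQ.domRestrict (S.comap (K ∙ x).mkQ))) ≤ 1 := by
    have h3 : finrank K (K ∙ x) ≤ 1 := (finrank_span_le_card {x}).trans (by simp)
    refine le_trans (LinearMap.finrank_le_finrank_of_injective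
      (f := (((S.comap (K ∙ x).mkQ).subtype ∘ₗ Submodule.subtype _).codRestrict (K ∙ x) ?_)) ?_) h3
    · rintro ⟨y, hy⟩
      have hy' : (K ∙ x).mkQ (y : V) = 0 := hy
      rwa [← LinearMap.mem_ker, Submodule.ker_mkQ] at hy'
    · intro a b hab
      have hab' := congrArg (Submodule.subtype (K ∙ x)) hab
      exact Subtype.ext (Subtype.ext hab')
  omega

universe u in
open Module in
/-- A linear form of the matroid intersection theorem: a finite set of pairs of vectors contains
`l` pairs whose first and second components are both linearly independent, where `l` is at least
the total dimension of some pair of subspaces covering the set. -/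
theorem exists_indep_pairs_of_cover {K : Type*} [Field K] (k : ℕ) :
    ∀ {V W : Type u} [AddCommGroup V] [Module K V] [FiniteDimensional K V]
      [AddCommGroup W] [Module K W] [FiniteDimensional K W] (E : Set (V × W)),
      E.Finite → E.ncard ≤ k →
      ∃ (l : ℕ) (v : Fin l → V) (w : Fin l → W) (A : Submodule K V) (B : Submodule K W),
        (∀ i, (v i, w i) ∈ E) ∧ LinearIndependent K v ∧ LinearIndependent K w ∧
        (∀ p ∈ E, p.1 ∈ A ∨ p.2 ∈ B) ∧ finrank K A + finrank K B ≤ l := by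
  induction k with
  | zero =>
    intro V W _ _ _ _ _ _ E hE hk
    have : E = ∅ := by
      rw [← Set.ncard_eq_zero hE]; omega
    subst this
    exact ⟨0, Fin.elim0, Fin.elim0, ⊥, ⊥, fun i => i.elim0, linearIndependent_empty_type,
      linearIndependent_empty_type, by simp, by simp⟩
  | succ k ih =>
    intro V W _ _ _ _ _ _ E hE hk
    by_cases htriv : ∀ p ∈ E, p.1 = 0 ∨ p.2 = 0
    · exact ⟨0, Fin.elim0, Fin.elim0, ⊥, ⊥, fun i => i.elim0, linearIndependent_empty_type,
        linearIndependent_empty_type, by simpa using htriv, by simp⟩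
    push Not at htriv
    obtain ⟨e, heE, he1, he2⟩ := htriv
    have hE' : (E \ {e}).Finite := hE.sdiff
    have hcard : (E \ {e}).ncard ≤ k := by
      have := Set.ncard_sdiff_singleton_add_one heE hE
      omega
    obtain ⟨l, v, w, A, B, hv, hvi, hwi, hAB, hl⟩ := ih (E \ {e}) hE' hcard
    let πV := (K ∙ e.1).mkQ
    let πW := (K ∙ e.2).mkQ
    let F : Set ((V ⧸ (K ∙ e.1)) × (W ⧸ (K ∙ e.2))) := (Prod.map πV πW) '' (E \ {e})
    obtain ⟨l', v', w', A', B', hv', hvi', hwi', hAB', hl'⟩ :=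
      ih F (hE'.image _) ((Set.ncard_image_le hE').trans hcard)
    choose p hpE hp using hv'
    have hlift1 : LinearIndependent K (Fin.cons e.1 (fun i => (p i).1) : Fin (l' + 1) → V) := by
      refine linearIndependent_cons_of_mkQ he1 _ ?_
      have hcomp : (fun i => (K ∙ e.1).mkQ (p i).1) = v' :=
        funext fun i => congrArg Prod.fst (hp i)
      rw [hcomp]
      exact hvi'
    have hlift2 : LinearIndependent K (Fin.cons e.2 (fun i => (p i).2) : Fin (l' + 1) → W) := by
      refine linearIndependent_cons_of_mkQ he2 _ ?_
      have hcomp : (fun i => (K ∙ e.2).mkQ (p i).2) = w' :=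
        funext fun i => congrArg Prod.snd (hp i)
      rw [hcomp]
      exact hwi'
    by_cases hcov : ∃ (A₀ : Submodule K V) (B₀ : Submodule K W),
        (∀ p ∈ E, p.1 ∈ A₀ ∨ p.2 ∈ B₀) ∧
        (finrank K A₀ + finrank K B₀ ≤ l ∨ finrank K A₀ + finrank K B₀ ≤ l' + 1)
    · obtain ⟨A₀, B₀, hc, h | h⟩ := hcov
      · exact ⟨l, v, w, A₀, B₀, fun i => (hv i).1, hvi, hwi, hc, h⟩
      · refine ⟨l' + 1, _, _, A₀, B₀, ?_, hlift1, hlift2, hc, h⟩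
        intro i
        refine Fin.cases ?_ (fun i => ?_) i
        · simpa using heE
        · simpa using (hpE i).1
    · push Not at hcov
      exfalso
      set A₂ := A'.comap πV
      set B₂ := B'.comap πW
      have hA₂ : finrank K A₂ ≤ finrank K A' + 1 := finrank_comap_mkQ_span_singleton_le _ _
      have hB₂ : finrank K B₂ ≤ finrank K B' + 1 := finrank_comap_mkQ_span_singleton_le _ _
      have heA : e.1 ∈ A₂ := by
        have : πV e.1 = 0 := by
          simp [πV, Submodule.mem_span_singleton_self]
        simp [A₂, this]
      have heB : e.2 ∈ B₂ := by
        have : πW e.2 = 0 := by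
          simp [πW, Submodule.mem_span_singleton_self]
        simp [B₂, this]
      have hcov2 : ∀ p ∈ E, p ≠ e → p.1 ∈ A₂ ∨ p.2 ∈ B₂ := by
        intro p hp hpe
        exact hAB' (Prod.map πV πW p) ⟨p, ⟨hp, hpe⟩, rfl⟩
      have h1 := hcov (A ⊓ A₂) (B ⊔ B₂) (by
        intro p hp
        by_cases hpe : p = e
        · subst hpe; exact Or.inr (Submodule.mem_sup_right heB)
        · rcases hAB p ⟨hp, hpe⟩ with h | h
          · rcases hcov2 p hp hpe with h' | h'
            · exact Or.inl ⟨h, h'⟩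
            · exact Or.inr (Submodule.mem_sup_right h')
          · exact Or.inr (Submodule.mem_sup_left h))
      have h2 := hcov (A ⊔ A₂) (B ⊓ B₂) (by
        intro p hp
        by_cases hpe : p = e
        · subst hpe; exact Or.inl (Submodule.mem_sup_right heA)
        · rcases hAB p ⟨hp, hpe⟩ with h | h
          · exact Or.inl (Submodule.mem_sup_left h)
          · rcases hcov2 p hp hpe with h' | h'
            · exact Or.inl (Submodule.mem_sup_right h')
            · exact Or.inr ⟨h, h'⟩)
      have e1 := Submodule.finrank_sup_add_finrank_inf_eq A A₂
      have e2 := Submodule.finrank_sup_add_finrank_inf_eq B B₂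
      omega

theorem exists_linearEquiv_of_finrank_range_eq {K V W : Type*} [Field K] [AddCommGroup V]
    [Module K V] [FiniteDimensional K V] [AddCommGroup W] [Module K W] [FiniteDimensional K W]
    (f g : V →ₗ[K] W)
    (h : Module.finrank K (LinearMap.range f) = Module.finrank K (LinearMap.range g)) :
    ∃ (φ : V ≃ₗ[K] V) (ψ : W ≃ₗ[K] W), ∀ x, ψ (f (φ x)) = g x := by
  have hf := f.finrank_range_add_finrank_ker
  have hg := g.finrank_range_add_finrank_ker
  obtain ⟨C, hC⟩ := (LinearMap.ker f).exists_isCompl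
  obtain ⟨C', hC'⟩ := (LinearMap.ker g).exists_isCompl
  obtain ⟨D, hD⟩ := (LinearMap.range f).exists_isCompl
  obtain ⟨D', hD'⟩ := (LinearMap.range g).exists_isCompl
  have hd := Submodule.finrank_add_eq_of_isCompl hD
  have hd' := Submodule.finrank_add_eq_of_isCompl hD'
  let τ : LinearMap.ker g ≃ₗ[K] LinearMap.ker f := LinearEquiv.ofFinrankEq _ _ (by omega)
  let σ : LinearMap.range f ≃ₗ[K] LinearMap.range g := LinearEquiv.ofFinrankEq _ _ h
  let δ : D ≃ₗ[K] D' := LinearEquiv.ofFinrankEq _ _ (by omega)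
  let r : C ≃ₗ[K] LinearMap.range f := f.kerComplementEquivRange hC.symm
  let r' : C' ≃ₗ[K] LinearMap.range g := g.kerComplementEquivRange hC'.symm
  let ψ : W ≃ₗ[K] W := (Submodule.prodEquivOfIsCompl _ _ hD).symm ≪≫ₗ
    (σ.prodCongr δ) ≪≫ₗ (Submodule.prodEquivOfIsCompl _ _ hD')
  let φ : V ≃ₗ[K] V := (Submodule.prodEquivOfIsCompl _ _ hC').symm ≪≫ₗ
    (τ.prodCongr (r' ≪≫ₗ σ.symm ≪≫ₗ r.symm)) ≪≫ₗ (Submodule.prodEquivOfIsCompl _ _ hC)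
  refine ⟨φ, ψ, fun x => ?_⟩
  obtain ⟨⟨a, b⟩, rfl⟩ := (Submodule.prodEquivOfIsCompl _ _ hC').surjective x
  have h1 : f (φ ((Submodule.prodEquivOfIsCompl _ _ hC') (a, b))) =
      (σ.symm (r' b) : W) := by
    have : f (r.symm (σ.symm (r' b))) = (r (r.symm (σ.symm (r' b))) : W) := rfl
    simp [φ, this, -LinearMap.coe_comp]
  rw [h1]
  have h2 : ψ (σ.symm (r' b) : W) = (r' b : W) := by
    simp [ψ]
  rw [h2]
  have h3 : (r' b : W) = g b := rfl
  simp [h3]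

/-- The trace form `⟨M, N⟩ = Tr(M Nᵗ)` as a bilinear form. -/
def codeForm (𝔽 : Type*) [Field 𝔽] (n m : ℕ) :
    LinearMap.BilinForm 𝔽 (Matrix (Fin n) (Fin m) 𝔽) :=
  LinearMap.mk₂ 𝔽 (fun M N => trace (M * Nᵀ))
    (fun a b c => by rw [Matrix.add_mul, trace_add])
    (fun c a b => by rw [Matrix.smul_mul, trace_smul])
    (fun a b c => by rw [transpose_add, Matrix.mul_add, trace_add])
    (fun c a b => by rw [transpose_smul, Matrix.mul_smul, trace_smul])

theorem trace_mul_transpose_comm {𝔽 : Type*} [Field 𝔽] {n m : ℕ}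
    (M N : Matrix (Fin n) (Fin m) 𝔽) : trace (M * Nᵀ) = trace (N * Mᵀ) := by
  rw [← trace_transpose, transpose_mul, transpose_transpose]

theorem trace_vecMulVec_mul_transpose {𝔽 : Type*} [Field 𝔽] {n m : ℕ}
    (x : Fin n → 𝔽) (y : Fin m → 𝔽) (N : Matrix (Fin n) (Fin m) 𝔽) :
    trace (vecMulVec x y * Nᵀ) = (x ᵥ* N) ⬝ᵥ y := by
  rw [vecMulVec_mul, trace_vecMulVec, vecMul_transpose, dotProduct_mulVec]

theorem codeForm_isRefl (𝔽 : Type*) [Field 𝔽] (n m : ℕ) : (codeForm 𝔽 n m).IsRefl := by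
  intro M N h
  change trace (N * Mᵀ) = 0
  rw [trace_mul_transpose_comm]
  exact h

theorem codeForm_nondegenerate (𝔽 : Type*) [Field 𝔽] (n m : ℕ) :
    (codeForm 𝔽 n m).Nondegenerate := by
  have h : (codeForm 𝔽 n m).SeparatingRight := by
    intro M hM
    ext i j
    have this : trace (vecMulVec (Pi.single i (1 : 𝔽)) (Pi.single j (1 : 𝔽)) * Mᵀ) = 0 := hM _
    rw [trace_vecMulVec_mul_transpose] at this
    simpa using this
  exact ⟨fun M hM => h M fun N => codeForm_isRefl 𝔽 n m _ _ (hM N), h⟩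

theorem dotProductBilin_nondegenerate (𝔽 : Type*) [Field 𝔽] (m : ℕ) :
    LinearMap.BilinForm.Nondegenerate
      (dotProductBilin 𝔽 𝔽 : LinearMap.BilinForm 𝔽 (Fin m → 𝔽)) := by
  refine ⟨fun x hx => ?_, fun x hx => ?_⟩
  · ext i; simpa using hx (Pi.single i 1)
  · ext i; simpa using hx (Pi.single i 1)

open Module Polynomial in
theorem finrank_ker_linearized_lt {F K : Type*} [Field F] [Fintype F] [Field K] [Algebra F K]
    [FiniteDimensional F K] {j : ℕ} (a : Fin j → K) (ha : a ≠ 0) :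
    finrank F (LinearMap.ker
      (∑ k, a k • ((FiniteField.frobeniusAlgHom F K) ^ (k : ℕ)).toLinearMap)) < j := by
  classical
  have : Finite K := Module.finite_of_finite F
  set L := ∑ k, a k • ((FiniteField.frobeniusAlgHom F K) ^ (k : ℕ)).toLinearMap
  set q := Fintype.card F
  have hq : 1 < q := Fintype.one_lt_card
  let P : K[X] := ∑ k : Fin j, C (a k) * X ^ (q ^ (k : ℕ))
  have hcoeff : ∀ k : Fin j, P.coeff (q ^ (k : ℕ)) = a k := by
    intro k
    simp only [P, finsetSum_coeff, coeff_C_mul, coeff_X_pow, mul_ite, mul_one, mul_zero]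
    rw [Finset.sum_eq_single k]
    · simp
    · intro b _ hb
      rw [if_neg]
      intro h
      exact hb (Fin.ext (Nat.pow_right_injective hq h).symm)
    · simp
  have hP : P ≠ 0 := by
    intro h
    apply ha
    ext k
    rw [← hcoeff k, h]; simp
  obtain ⟨k₀, -⟩ := Function.ne_iff.1 ha
  have hj : 0 < j := k₀.pos
  have hdeg : P.natDegree ≤ q ^ (j - 1) := by
    apply natDegree_sum_le_of_forall_le
    intro k _
    refine (natDegree_C_mul_X_pow_le _ _).trans (Nat.pow_le_pow_right (by omega) (by omega))
  have hfrob : ∀ (k : ℕ) (x : K), ((FiniteField.frobeniusAlgHom F K) ^ k) x = x ^ (q ^ k) := by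
    intro k
    induction k with
    | zero => intro x; simp
    | succ k ih =>
      intro x
      rw [pow_succ, AlgHom.mul_apply, ih]
      simp only [FiniteField.coe_frobeniusAlgHom]
      rw [← pow_mul, pow_succ, mul_comm]
  have hL : ∀ x, L x = P.eval x := by
    intro x
    simp [L, P, eval_finsetSum, hfrob, -AlgHom.coe_pow]
  have hsub : ((LinearMap.ker L : Submodule F K) : Set K) ⊆ (P.roots.toFinset : Set K) := by
    intro x hx
    simp only [Finset.mem_coe, Multiset.mem_toFinset, mem_roots hP, IsRoot.def]
    rw [← hL]; exact hx
  have hcard : Nat.card (LinearMap.ker L) ≤ q ^ (j - 1) := by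
    calc Nat.card (LinearMap.ker L) = Set.ncard ((LinearMap.ker L : Submodule F K) : Set K) := rfl
      _ ≤ Set.ncard (P.roots.toFinset : Set K) := Set.ncard_le_ncard hsub (Finset.finite_toSet _)
      _ = P.roots.toFinset.card := Set.ncard_coe_finset _
      _ ≤ P.roots.card := Multiset.toFinset_card_le _
      _ ≤ P.natDegree := card_roots' P
      _ ≤ _ := hdeg
  rw [Module.natCard_eq_pow_finrank (K := F), Nat.card_eq_fintype_card] at hcard
  have := (Nat.pow_le_pow_iff_right hq).1 hcard
  omega

open Module in
/-- Existence of Gabidulin codes, that is, of codes of dimension `m * j` whose nonzero elements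
all have rank larger than `n - j`. -/
theorem exists_mrd (𝔽 : Type*) [Field 𝔽] [Fintype 𝔽] {n m j : ℕ} (hnm : n ≤ m) (hj : j ≤ n)
    (hm : 0 < m) :
    ∃ D : Submodule 𝔽 (Matrix (Fin n) (Fin m) 𝔽), finrank 𝔽 D = m * j ∧
      ∀ M ∈ D, M ≠ 0 → n - j < M.rank := by
  classical
  obtain ⟨p, hp⟩ := CharP.exists 𝔽
  have hpp : Fact p.Prime := ⟨CharP.char_is_prime 𝔽 p⟩
  have : NeZero m := ⟨hm.ne'⟩
  let K := FiniteField.Extension 𝔽 p m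
  have hK : finrank 𝔽 K = m := FiniteField.finrank_extension 𝔽 p m
  let c : Basis (Fin m) 𝔽 K := finBasisOfFinrankEq 𝔽 K hK
  let L : (Fin j → K) →ₗ[𝔽] (K →ₗ[𝔽] K) :=
    { toFun := fun a => ∑ k, a k • ((FiniteField.frobeniusAlgHom 𝔽 K) ^ (k : ℕ)).toLinearMap
      map_add' := fun a b => by simp [add_smul, Finset.sum_add_distrib]
      map_smul' := fun r a => by simp [Finset.smul_sum] }
  let G : (Fin j → K) →ₗ[𝔽] Matrix (Fin n) (Fin m) 𝔽 :=
    { toFun := fun a => Matrix.of fun i l => c.repr (L a (c (Fin.castLE hnm i))) l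
      map_add' := fun a b => by ext; simp
      map_smul' := fun r a => by ext; simp }
  have hrank : ∀ a, a ≠ 0 → n - j < (G a).rank := by
    intro a ha
    have h1 : finrank 𝔽 (LinearMap.ker (L a)) < j := finrank_ker_linearized_lt a ha
    rw [← rank_transpose, Matrix.rank]
    have h2 := LinearMap.finrank_range_add_finrank_ker (G a)ᵀ.mulVecLin
    rw [finrank_fin_fun] at h2
    let ι : (Fin n → 𝔽) →ₗ[𝔽] K := Fintype.linearCombination 𝔽 (fun i => c (Fin.castLE hnm i))
    have hι : Function.Injective ι := by
      have : LinearIndependent 𝔽 (fun i => c (Fin.castLE hnm i)) :=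
        c.linearIndependent.comp _ (Fin.castLE_injective hnm)
      exact this.fintypeLinearCombination_injective
    have h4 : ∀ v, c.equivFun (L a (ι v)) = (G a)ᵀ *ᵥ v := by
      intro v
      ext l
      simp [ι, Fintype.linearCombination_apply, mulVec, dotProduct, G, mul_comm]
    have h3 : finrank 𝔽 (LinearMap.ker (G a)ᵀ.mulVecLin) ≤ finrank 𝔽 (LinearMap.ker (L a)) := by
      have hmem : ∀ v ∈ LinearMap.ker (G a)ᵀ.mulVecLin, ι v ∈ LinearMap.ker (L a) := by
        intro v hv
        rw [LinearMap.mem_ker, mulVecLin_apply, ← h4] at hv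
        exact c.equivFun.map_eq_zero_iff.1 hv
      refine LinearMap.finrank_le_finrank_of_injective (f := ι.restrict hmem) ?_
      intro x y hxy
      exact Subtype.ext (hι (Subtype.ext_iff.1 hxy))
    omega
  have hinj : Function.Injective G := by
    rw [← LinearMap.ker_eq_bot, LinearMap.ker_eq_bot']
    intro a ha
    by_contra h
    have := hrank a h
    rw [ha, rank_zero] at this
    omega
  refine ⟨LinearMap.range G, ?_, ?_⟩
  · rw [LinearMap.finrank_range_of_inj hinj, finrank_pi_fintype]
    simp [hK, mul_comm]
  · rintro _ ⟨a, rfl⟩ hM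
    apply hrank
    rintro rfl
    simp at hM

open Module in
theorem Submodule.exists_le_finrank_eq {K V : Type*} [Field K] [AddCommGroup V] [Module K V]
    [FiniteDimensional K V] (R : Submodule K V) (d : ℕ) (hR : finrank K R ≤ d)
    (hd : d ≤ finrank K V) : ∃ U : Submodule K V, R ≤ U ∧ finrank K U = d := by
  induction d, hR using Nat.le_induction with
  | base => exact ⟨R, le_rfl, rfl⟩
  | succ d _ ih =>
    obtain ⟨U, hRU, hU⟩ := ih (by omega)
    obtain ⟨v, hv⟩ := U.exists_of_finrank_lt (by omega)
    have hv' : v ∉ U := fun h => hv 1 one_ne_zero (by simpa using h)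
    refine ⟨U ⊔ span K {v}, hRU.trans le_sup_left, ?_⟩
    have hv0 : v ≠ 0 := by rintro rfl; exact hv' U.zero_mem
    have h1 := Submodule.finrank_sup_add_finrank_inf_eq U (span K {v})
    have h2 : U ⊓ span K {v} = ⊥ :=
      disjoint_iff.1 ((Submodule.disjoint_span_singleton_of_notMem hv'))
    rw [h2, finrank_bot, finrank_span_singleton hv0, hU] at h1
    omega

section
variable {𝔽 : Type*} [Field 𝔽] {n m : ℕ}

open Module

theorem finrank_matCol (W : Submodule 𝔽 (Fin n → 𝔽)) :
    finrank 𝔽 (matCol W : Submodule 𝔽 (Matrix (Fin n) (Fin m) 𝔽)) = m * finrank 𝔽 W := by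
  let e : (matCol W : Submodule 𝔽 (Matrix (Fin n) (Fin m) 𝔽)) ≃ₗ[𝔽] (Fin m → W) :=
    { toFun := fun M j => ⟨fun i => M.1 i j, M.2 j⟩
      map_add' := fun _ _ => rfl
      map_smul' := fun _ _ => rfl
      invFun := fun f => ⟨fun i j => (f j).1 i, fun j => (f j).2⟩
      left_inv := fun _ => rfl
      right_inv := fun _ => rfl }
  rw [e.finrank_eq, finrank_pi_fintype]
  simp

theorem mem_matCol_range (M : Matrix (Fin n) (Fin m) 𝔽) :
    M ∈ matCol (LinearMap.range M.mulVecLin) := by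
  intro j
  refine ⟨Pi.single j 1, ?_⟩
  ext i
  simp

theorem rank_le_of_mem_matCol {W : Submodule 𝔽 (Fin n → 𝔽)} {M : Matrix (Fin n) (Fin m) 𝔽}
    (hM : M ∈ matCol W) : M.rank ≤ finrank 𝔽 W := by
  refine Submodule.finrank_mono ?_
  rw [Matrix.range_mulVecLin, Submodule.span_le]
  rintro _ ⟨j, rfl⟩
  exact hM j

theorem trace_mul_transpose_eq (M N : Matrix (Fin n) (Fin m) 𝔽) :
    trace (M * Nᵀ) = ∑ j, (fun i => M i j) ⬝ᵥ (fun i => N i j) := by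
  simp only [trace, Matrix.diag, Matrix.mul_apply, dotProduct, transpose_apply]
  rw [Finset.sum_comm]

theorem eq_zero_of_mrd_orthogonal {j : ℕ} (hj : j ≤ n)
    {D : Submodule 𝔽 (Matrix (Fin n) (Fin m) 𝔽)} (hD : finrank 𝔽 D = m * j)
    (hDr : ∀ M ∈ D, M ≠ 0 → n - j < M.rank) {N : Matrix (Fin n) (Fin m) 𝔽}
    (hN : ∀ M ∈ D, trace (N * Mᵀ) = 0) (hr : N.rank ≤ j) : N = 0 := by
  obtain ⟨U, hU, hUj⟩ := (LinearMap.range N.mulVecLin).exists_le_finrank_eq j hr (by simpa)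
  set W := LinearMap.BilinForm.orthogonal
    (dotProductBilin 𝔽 𝔽 : LinearMap.BilinForm 𝔽 (Fin n → 𝔽)) U
  have hW : finrank 𝔽 W = n - j := by
    have := LinearMap.BilinForm.finrank_orthogonal (dotProductBilin_nondegenerate 𝔽 n) U
    rw [finrank_fin_fun, hUj] at this
    exact this
  have h0 : D ⊓ matCol W = ⊥ := by
    rw [eq_bot_iff]
    rintro M ⟨h1, h2⟩
    by_contra h
    have := hDr M h1 h
    have := rank_le_of_mem_matCol h2
    omega
  have h1 := Submodule.finrank_sup_add_finrank_inf_eq D (matCol W)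
  rw [h0, finrank_bot, hD, finrank_matCol, hW, ← mul_add, Nat.add_sub_cancel' hj] at h1
  have htop : D ⊔ matCol W = ⊤ := by
    apply Submodule.eq_top_of_finrank_eq
    rw [finrank_matrix]
    simp only [Fintype.card_fin, finrank_self]
    rw [mul_comm n m]; omega
  have hle : D ⊔ matCol W ≤ LinearMap.ker (codeForm 𝔽 n m N) := by
    refine sup_le (fun M hM => hN M hM) fun M hM => ?_
    have : trace (N * Mᵀ) = 0 := by
      rw [trace_mul_transpose_eq]
      exact Finset.sum_eq_zero fun i _ => hM i _ (hU (mem_matCol_range N i))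
    exact this
  rw [htop] at hle
  exact (codeForm_nondegenerate 𝔽 n m).1 N fun M => hle (Submodule.mem_top (x := M))

theorem sup_mrd_eq_top {j : ℕ} (hj : j ≤ n) {C : Submodule 𝔽 (Matrix (Fin n) (Fin m) 𝔽)}
    (hC : ∀ N ∈ dualCode C, N.rank ≤ j)
    {D : Submodule 𝔽 (Matrix (Fin n) (Fin m) 𝔽)} (hD : finrank 𝔽 D = m * j)
    (hDr : ∀ M ∈ D, M ≠ 0 → n - j < M.rank) : C ⊔ D = ⊤ := by
  apply Submodule.eq_top_of_finrank_eq
  have h := LinearMap.BilinForm.finrank_orthogonal (codeForm_nondegenerate 𝔽 n m) (C ⊔ D)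
  have h0 : LinearMap.BilinForm.orthogonal (codeForm 𝔽 n m) (C ⊔ D) = ⊥ := by
    rw [eq_bot_iff]
    intro N hN
    have key : ∀ M ∈ C ⊔ D, trace (N * Mᵀ) = 0 := by
      intro M hM
      rw [trace_mul_transpose_comm]
      exact hN M hM
    exact eq_zero_of_mrd_orthogonal hj hD hDr
      (fun M hM => key M (Submodule.mem_sup_right hM))
      (hC N fun M hM => key M (Submodule.mem_sup_left hM))
  rw [h0, finrank_bot] at h
  have := (C ⊔ D).finrank_le
  omega

theorem exists_units_of_rank_eq {M M' : Matrix (Fin n) (Fin m) 𝔽} (h : M.rank = M'.rank) :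
    ∃ (g : (Matrix (Fin n) (Fin n) 𝔽)ˣ) (k : (Matrix (Fin m) (Fin m) 𝔽)ˣ),
      M' = g.1 * M * k.1 := by
  obtain ⟨φ, ψ, hφ⟩ := exists_linearEquiv_of_finrank_range_eq M.mulVecLin M'.mulVecLin h
  have unit : ∀ {l : ℕ} (e : (Fin l → 𝔽) ≃ₗ[𝔽] (Fin l → 𝔽)),
      IsUnit (LinearMap.toMatrix' e.toLinearMap) := by
    intro l e
    refine IsUnit.of_mul_eq_one (LinearMap.toMatrix' e.symm.toLinearMap) ?_
    rw [← LinearMap.toMatrix'_comp]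
    simp
  refine ⟨(unit ψ).unit, (unit φ).unit, ?_⟩
  apply Matrix.toLin'.injective
  ext1 x
  have := hφ (Pi.single x 1)
  simp only [mulVecLin_apply, mulVec_single_one] at this
  ext i
  simp [Matrix.toLin'_mul, LinearMap.comp_apply, this]

theorem dualCode_eq_orthogonal (C : Submodule 𝔽 (Matrix (Fin n) (Fin m) 𝔽)) :
    dualCode C = LinearMap.BilinForm.orthogonal (codeForm 𝔽 n m) C := by
  ext N
  constructor
  · intro h M hM
    have : trace (M * Nᵀ) = 0 := by rw [trace_mul_transpose_comm]; exact h M hM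
    exact this
  · intro h M hM
    rw [trace_mul_transpose_comm]
    exact h M hM

theorem finrank_dualCode (C : Submodule 𝔽 (Matrix (Fin n) (Fin m) 𝔽)) :
    finrank 𝔽 (dualCode C) = n * m - finrank 𝔽 C := by
  rw [dualCode_eq_orthogonal, LinearMap.BilinForm.finrank_orthogonal
    (codeForm_nondegenerate 𝔽 n m), finrank_matrix]
  simp

theorem finrank_code_le (C : Submodule 𝔽 (Matrix (Fin n) (Fin m) 𝔽)) :
    finrank 𝔽 C ≤ n * m := by
  refine C.finrank_le.trans ?_
  rw [finrank_matrix]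
  simp

theorem dualCode_dualCode (C : Submodule 𝔽 (Matrix (Fin n) (Fin m) 𝔽)) :
    dualCode (dualCode C) = C := by
  rw [dualCode_eq_orthogonal, dualCode_eq_orthogonal]
  exact LinearMap.BilinForm.orthogonal_orthogonal (codeForm_nondegenerate 𝔽 n m)
    (codeForm_isRefl 𝔽 n m) C

theorem eq_zero_of_rank_eq_zero {M : Matrix (Fin n) (Fin m) 𝔽} (h : M.rank = 0) : M = 0 := by
  have h1 := mem_matCol_range M
  rw [Submodule.finrank_eq_zero.1 h] at h1
  ext i j
  exact congrFun ((Submodule.mem_bot 𝔽).1 (h1 j)) i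

theorem finrank_inf_comap_mrd (g : (Matrix (Fin n) (Fin n) 𝔽)ˣ) (k : (Matrix (Fin m) (Fin m) 𝔽)ˣ)
    {j : ℕ} (hj : j ≤ n)
    {C : Submodule 𝔽 (Matrix (Fin n) (Fin m) 𝔽)} (hC : ∀ N ∈ dualCode C, N.rank ≤ j)
    {D : Submodule 𝔽 (Matrix (Fin n) (Fin m) 𝔽)} (hD : finrank 𝔽 D = m * j)
    (hDr : ∀ M ∈ D, M ≠ 0 → n - j < M.rank) :
    ∃ D' : Submodule 𝔽 (Matrix (Fin n) (Fin m) 𝔽), (∀ M, M ∈ D' ↔ g.1 * M * k.1 ∈ D) ∧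
      finrank 𝔽 (C ⊓ D' : Submodule 𝔽 (Matrix (Fin n) (Fin m) 𝔽)) + n * m =
        finrank 𝔽 C + m * j := by
  let e : Matrix (Fin n) (Fin m) 𝔽 ≃ₗ[𝔽] Matrix (Fin n) (Fin m) 𝔽 :=
    { toFun := fun M => g.1 * M * k.1
      map_add' := fun A B => by rw [Matrix.mul_add, Matrix.add_mul]
      map_smul' := fun c A => by simp
      invFun := fun M => g⁻¹.1 * M * k⁻¹.1
      left_inv := fun M => by
        have h1 : g⁻¹.1 * g.1 = 1 := g.inv_mul
        have h2 : k.1 * k⁻¹.1 = 1 := k.mul_inv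
        calc g⁻¹.1 * (g.1 * M * k.1) * k⁻¹.1 = (g⁻¹.1 * g.1) * M * (k.1 * k⁻¹.1) := by
              simp only [Matrix.mul_assoc]
          _ = M := by rw [h1, h2, Matrix.one_mul, Matrix.mul_one]
      right_inv := fun M => by
        have h1 : g.1 * g⁻¹.1 = 1 := g.mul_inv
        have h2 : k⁻¹.1 * k.1 = 1 := k.inv_mul
        calc g.1 * (g⁻¹.1 * M * k⁻¹.1) * k.1 = (g.1 * g⁻¹.1) * M * (k⁻¹.1 * k.1) := by
              simp only [Matrix.mul_assoc]
          _ = M := by rw [h1, h2, Matrix.one_mul, Matrix.mul_one] }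
  have hrk : ∀ M, (e M).rank = M.rank := by
    intro M
    change (g.1 * M * k.1).rank = M.rank
    rw [rank_mul_eq_left_of_isUnit_det _ _ ((isUnit_iff_isUnit_det _).1 k.isUnit),
      rank_mul_eq_right_of_isUnit_det _ _ ((isUnit_iff_isUnit_det _).1 g.isUnit)]
  refine ⟨D.comap e.toLinearMap, fun M => Iff.rfl, ?_⟩
  have hf : finrank 𝔽 (D.comap e.toLinearMap) = m * j := by
    rw [← hD]
    have := LinearEquiv.finrank_eq (e.submoduleMap (D.comap e.toLinearMap))
    rw [this]
    have h2 : (D.comap e.toLinearMap).map e.toLinearMap = D :=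
      Submodule.map_comap_eq_of_surjective e.surjective D
    exact congrArg (fun S : Submodule 𝔽 (Matrix (Fin n) (Fin m) 𝔽) => finrank 𝔽 S) h2
  have hr : ∀ M ∈ D.comap e.toLinearMap, M ≠ 0 → n - j < M.rank := by
    intro M hM h0
    rw [← hrk]
    exact hDr _ hM (fun h => h0 (e.map_eq_zero_iff.1 h))
  have h1 := Submodule.finrank_sup_add_finrank_inf_eq C (D.comap e.toLinearMap)
  rw [sup_mrd_eq_top hj hC hf hr, finrank_top, finrank_matrix, hf] at h1
  simp only [Fintype.card_fin, finrank_self] at h1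
  omega

theorem exists_mem_rank_eq_of_mrd {j : ℕ} (hj : j ≤ n) (hj0 : 0 < j) (hm : 0 < m)
    {D : Submodule 𝔽 (Matrix (Fin n) (Fin m) 𝔽)} (hD : finrank 𝔽 D = m * j)
    (hDr : ∀ M ∈ D, M ≠ 0 → n - j < M.rank) : ∃ M ∈ D, M.rank = n + 1 - j := by
  obtain ⟨U, -, hU⟩ := (⊥ : Submodule 𝔽 (Fin n → 𝔽)).exists_le_finrank_eq (n + 1 - j)
    (by simp) (by simp; omega)
  have h1 := Submodule.finrank_sup_add_finrank_inf_eq D (matCol U)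
  have h2 := finrank_code_le (D ⊔ matCol U)
  rw [finrank_matCol, hD, hU] at h1
  have h3 : m * j + m * (n + 1 - j) = n * m + m := by
    rw [← mul_add, show j + (n + 1 - j) = n + 1 by omega]; ring
  have h4 : D ⊓ matCol U ≠ ⊥ := by
    intro h
    rw [h, finrank_bot] at h1
    omega
  obtain ⟨M, hM, h0⟩ := Submodule.exists_mem_ne_zero_of_ne_bot h4
  refine ⟨M, hM.1, ?_⟩
  have h5 := hDr M hM.1 h0
  have h6 := rank_le_of_mem_matCol hM.2
  omega

open Classical in
/-- The total weight of a code with respect to a function that only depends on the rank, when the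
ranks in the code and its dual are at most `r` and `n + 1 - r`, is determined by the dimension. -/
theorem sum_eq_sum_of_rank_le [Fintype 𝔽] (hnm : n ≤ m) {r : ℕ}
    (hrn : r ≤ n) {C C' : Submodule 𝔽 (Matrix (Fin n) (Fin m) 𝔽)}
    (hCC' : finrank 𝔽 C = finrank 𝔽 C')
    (hC : ∀ M ∈ C, M.rank ≤ r) (hC' : ∀ M ∈ C', M.rank ≤ r)
    (hE : ∀ N ∈ dualCode C, N.rank ≤ n + 1 - r) (hE' : ∀ N ∈ dualCode C', N.rank ≤ n + 1 - r)
    (F : Matrix (Fin n) (Fin m) 𝔽 → ℕ)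
    (hF : ∀ (g : (Matrix (Fin n) (Fin n) 𝔽)ˣ) (k : (Matrix (Fin m) (Fin m) 𝔽)ˣ) M,
      F (g.1 * M * k.1) = F M) :
    ∑ M with M ∈ C, F M = ∑ M with M ∈ C', F M := by
  have hmod : ∀ (F : Matrix (Fin n) (Fin m) 𝔽 → ℕ),
      (∀ (g : (Matrix (Fin n) (Fin n) 𝔽)ˣ) (k : (Matrix (Fin m) (Fin m) 𝔽)ˣ) M,
        F (g.1 * M * k.1) = F M) → ∃ ω : ℕ → ℕ, ∀ M, F M = ω M.rank := by
    intro F hF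
    refine ⟨fun i => if h : ∃ M : Matrix (Fin n) (Fin m) 𝔽, M.rank = i then F h.choose else 0, ?_⟩
    intro M
    have h : ∃ M' : Matrix (Fin n) (Fin m) 𝔽, M'.rank = M.rank := ⟨M, rfl⟩
    simp only [h, dite_true]
    obtain ⟨g, k, hgk⟩ := exists_units_of_rank_eq h.choose_spec
    conv_lhs => rw [hgk, hF]
  let A : Submodule 𝔽 (Matrix (Fin n) (Fin m) 𝔽) → ℕ → ℕ := fun C i =>
    Finset.card {M : Matrix (Fin n) (Fin m) 𝔽 | M ∈ C ∧ M.rank = i}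
  have hsum : ∀ (C : Submodule 𝔽 (Matrix (Fin n) (Fin m) 𝔽)) (ω : ℕ → ℕ),
      ∑ M with M ∈ C, ω M.rank = ∑ i ∈ Finset.range (n + 1), A C i * ω i := by
    intro C ω
    rw [← Finset.sum_fiberwise_of_maps_to (g := Matrix.rank) (t := Finset.range (n + 1))]
    · refine Finset.sum_congr rfl fun i _ => ?_
      rw [Finset.sum_congr rfl (g := fun _ => ω i)]
      · rw [Finset.sum_const, smul_eq_mul, Finset.filter_filter]
      · intro M hM
        rw [(Finset.mem_filter.1 hM).2]
    · intro M _
      have := M.rank_le_height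
      simp; omega
  have key : ∀ i, A C i = A C' i := by
    have hzero : ∀ (C : Submodule 𝔽 (Matrix (Fin n) (Fin m) 𝔽)), A C 0 = 1 := by
      intro C
      refine Finset.card_eq_one.2 ⟨0, ?_⟩
      ext M
      simp only [Finset.mem_filter, Finset.mem_univ, true_and, Finset.mem_singleton]
      constructor
      · exact fun h => eq_zero_of_rank_eq_zero h.2
      · rintro rfl; exact ⟨C.zero_mem, rank_zero⟩
    have hbig : ∀ (C : Submodule 𝔽 (Matrix (Fin n) (Fin m) 𝔽)) (i : ℕ),
        (∀ M ∈ C, M.rank ≤ r) → r < i → A C i = 0 := by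
      intro C i hC hi
      refine Finset.card_eq_zero.2 (Finset.filter_eq_empty_iff.2 ?_)
      rintro M - ⟨h1, h2⟩
      have := hC M h1
      omega
    by_contra hne
    push Not at hne
    obtain ⟨i₀, hi₀⟩ := hne
    have hbd : ∀ i, A C i ≠ A C' i → i ≤ r := by
      intro i hi
      by_contra h
      exact hi (by rw [hbig C i hC (by omega), hbig C' i hC' (by omega)])
    set i := Nat.findGreatest (fun i => A C i ≠ A C' i) r with hi
    have hspec : A C i ≠ A C' i :=
      Nat.findGreatest_spec (P := fun i => A C i ≠ A C' i) (hbd i₀ hi₀) hi₀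
    have hgt : ∀ i', i < i' → A C i' = A C' i' := by
      intro i' hi'
      by_contra h
      have := Nat.le_findGreatest (P := fun i => A C i ≠ A C' i) (hbd i' h) h
      omega
    have hir := hbd i hspec
    have hi0 : 0 < i := by
      rw [Nat.pos_iff_ne_zero]
      intro h
      apply hspec
      rw [h, hzero, hzero]
    have hm : 0 < m := by omega
    obtain ⟨D, hD, hDr⟩ := exists_mrd 𝔽 (j := n + 1 - i) hnm (by omega) hm
    let w : Matrix (Fin n) (Fin m) 𝔽 → ℕ := fun M =>
      Finset.card {p : (Matrix (Fin n) (Fin n) 𝔽)ˣ × (Matrix (Fin m) (Fin m) 𝔽)ˣ |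
        p.1.1 * M * p.2.1 ∈ D}
    obtain ⟨ω, hω⟩ := hmod w (by
      intro g k M
      refine Finset.card_equiv ((Equiv.mulRight g).prodCongr (Equiv.mulLeft k)) ?_
      intro p
      simp [Matrix.mul_assoc])
    have hcount : ∀ (C : Submodule 𝔽 (Matrix (Fin n) (Fin m) 𝔽)),
        (∀ N ∈ dualCode C, N.rank ≤ n + 1 - r) →
        ∑ M with M ∈ C, w M =
          Fintype.card ((Matrix (Fin n) (Fin n) 𝔽)ˣ × (Matrix (Fin m) (Fin m) 𝔽)ˣ) *
          Fintype.card 𝔽 ^ (finrank 𝔽 C + m * (n + 1 - i) - n * m) := by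
      intro C hE
      simp only [w, Finset.card_filter]
      rw [Finset.sum_comm, ← smul_eq_mul, ← Finset.card_univ]
      refine Finset.sum_eq_card_nsmul fun p _ => ?_
      obtain ⟨D', hD', hfin⟩ := finrank_inf_comap_mrd p.1 p.2 (by omega)
        (fun N hN => (hE N hN).trans (by omega)) hD hDr
      rw [← Finset.card_filter, Finset.filter_filter,
        show finrank 𝔽 C + m * (n + 1 - i) - n * m =
          finrank 𝔽 (C ⊓ D' : Submodule 𝔽 (Matrix (Fin n) (Fin m) 𝔽)) by omega,
        ← Nat.card_eq_fintype_card, ← Module.natCard_eq_pow_finrank, Nat.card_eq_fintype_card,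
        Fintype.card_subtype]
      simp only [Submodule.mem_inf, hD']
    have h1 := hcount C hE
    have h2 := hcount C' hE'
    rw [← hCC', ← h1] at h2
    simp only [hω] at h2
    rw [hsum, hsum] at h2
    have hin : i ∈ Finset.range (n + 1) := by simp; omega
    rw [← Finset.add_sum_erase _ _ hin, ← Finset.add_sum_erase _ _ hin,
      Finset.sum_congr rfl (g := fun i => A C i * ω i)] at h2
    · have hωi : 0 < ω i := by
        obtain ⟨M, hM, hr⟩ := exists_mem_rank_eq_of_mrd (by omega) (by omega) hm hD hDr
        have : M.rank = i := by omega
        rw [← this, ← hω]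
        refine Finset.card_pos.2 ⟨(1, 1), ?_⟩
        simpa using hM
      have h3 : A C' i * ω i = A C i * ω i := Nat.add_right_cancel h2
      exact hspec (Nat.eq_of_mul_eq_mul_right hωi h3).symm
    · intro i' hi'
      rw [Finset.mem_erase] at hi'
      rcases lt_or_ge i i' with h | h
      · rw [hgt i' h]
      · rcases Nat.eq_zero_or_pos i' with h0 | h0
        · rw [h0, hzero, hzero]
        · have : A C i' * ω i' = 0 ∧ A C' i' * ω i' = 0 := by
            have hz : (∃ M : Matrix (Fin n) (Fin m) 𝔽, M.rank = i') → ω i' = 0 := by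
              rintro ⟨M, hM⟩
              rw [← hM, ← hω]
              refine Finset.card_eq_zero.2 (Finset.filter_eq_empty_iff.2 ?_)
              intro p _ hp
              have hrk : (p.1.1 * M * p.2.1).rank = i' := by
                rw [rank_mul_eq_left_of_isUnit_det _ _ ((isUnit_iff_isUnit_det _).1 p.2.isUnit),
                  rank_mul_eq_right_of_isUnit_det _ _ ((isUnit_iff_isUnit_det _).1 p.1.isUnit), hM]
              have := hDr _ hp (by intro h; rw [h, rank_zero] at hrk; omega)
              omega
            by_cases hex : ∃ M : Matrix (Fin n) (Fin m) 𝔽, M.rank = i'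
            · simp [hz hex]
            · have : ∀ C, A C i' = 0 := by
                intro C
                refine Finset.card_eq_zero.2 (Finset.filter_eq_empty_iff.2 ?_)
                rintro M - ⟨-, h2⟩
                exact hex ⟨M, h2⟩
              simp [this]
          rw [this.1, this.2]
  obtain ⟨ω, hω⟩ := hmod F hF
  simp only [hω, hsum, key]

open Classical in
theorem card_filter_mem_submodule [Fintype 𝔽] {V : Type*} [AddCommGroup V] [Module 𝔽 V]
    [Fintype V] (S : Submodule 𝔽 V) :
    Finset.card {v | v ∈ S} = Fintype.card 𝔽 ^ finrank 𝔽 S := by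
  rw [← Nat.card_eq_fintype_card, ← Module.natCard_eq_pow_finrank, Nat.card_eq_fintype_card,
    Fintype.card_subtype]

open Classical in
theorem card_filter_eq_zero_of_le [Fintype 𝔽] {s : ℕ} (hs : s ≤ n) :
    Finset.card {x : Fin n → 𝔽 | ∀ i : Fin n, s ≤ (i : ℕ) → x i = 0} = Fintype.card 𝔽 ^ s := by
  have h : ({x : Fin n → 𝔽 | ∀ i : Fin n, s ≤ (i : ℕ) → x i = 0} : Finset (Fin n → 𝔽)) =
      Fintype.piFinset fun i : Fin n => if (i : ℕ) < s then Finset.univ else {0} := by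
    ext x
    simp only [Finset.mem_filter, Finset.mem_univ, true_and, Fintype.mem_piFinset]
    refine forall_congr' fun i => ?_
    by_cases h : (i : ℕ) < s
    · simp [h]
    · simp [h, not_lt.1 h]
  rw [h, Fintype.card_piFinset]
  have h2 : ∀ i : Fin n, (if (i : ℕ) < s then (Finset.univ : Finset 𝔽) else {0}).card =
      if (i : ℕ) < s then Fintype.card 𝔽 else 1 := by
    intro i; split_ifs <;> simp
  rw [Finset.prod_congr rfl fun i _ => h2 i, Finset.prod_ite, Finset.prod_const, Finset.prod_const,
    one_pow, mul_one, Fin.card_filter_val_lt, min_eq_right hs]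

theorem finrank_zeroOutside (P : Fin n → Fin m → Prop) [∀ i, DecidablePred (P i)] :
    finrank 𝔽 (zeroOutside P : Submodule 𝔽 (Matrix (Fin n) (Fin m) 𝔽)) =
      ∑ i, Finset.card {j | P i j} := by
  let e : (zeroOutside P : Submodule 𝔽 (Matrix (Fin n) (Fin m) 𝔽)) ≃ₗ[𝔽]
      ((Σ i, {j // P i j}) → 𝔽) :=
    { toFun := fun M p => M.1 p.1 p.2
      map_add' := fun _ _ => rfl
      map_smul' := fun _ _ => rfl
      invFun := fun f => ⟨fun i j => if h : P i j then f ⟨i, j, h⟩ else 0,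
        fun i j h => by simp [h]⟩
      left_inv := fun M => by
        ext i j
        by_cases h : P i j
        · simp [h]
        · simp [h, M.2 i j h]
      right_inv := fun f => by
        ext ⟨i, j, h⟩
        simp [h] }
  rw [e.finrank_eq, finrank_fintype_fun_eq_card, Fintype.card_sigma]
  simp only [Fintype.card_subtype]

theorem finrank_zeroOutside_steps {u v w : ℕ} (huv : u ≤ v) (hv : v ≤ n) (hw : w ≤ m) :
    finrank 𝔽 (zeroOutside (fun (i : Fin n) (j : Fin m) =>
      (i : ℕ) < u ∨ ((i : ℕ) < v ∧ (j : ℕ) < w)) : Submodule 𝔽 (Matrix (Fin n) (Fin m) 𝔽)) =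
      u * m + (v - u) * w := by
  classical
  rw [finrank_zeroOutside]
  have h : ∀ i : Fin n,
      Finset.card {j : Fin m | (i : ℕ) < u ∨ ((i : ℕ) < v ∧ (j : ℕ) < w)} =
        (if (i : ℕ) < u then m - w else 0) + if (i : ℕ) < v then w else 0 := by
    intro i
    by_cases h1 : (i : ℕ) < u
    · simp [h1, h1.trans_le huv, Nat.sub_add_cancel hw]
    · by_cases h2 : (i : ℕ) < v
      · simp [h1, h2, Fin.card_filter_val_lt, hw]
      · simp [h1, h2]
  rw [Finset.sum_congr rfl fun i _ => h i, Finset.sum_add_distrib, ← Finset.sum_filter,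
    ← Finset.sum_filter, Finset.sum_const, Finset.sum_const, Fin.card_filter_val_lt,
    Fin.card_filter_val_lt, min_eq_right hv, min_eq_right (huv.trans hv)]
  obtain ⟨d, rfl⟩ := Nat.exists_eq_add_of_le huv
  obtain ⟨d', rfl⟩ := Nat.exists_eq_add_of_le hw
  simp only [add_tsub_cancel_left, smul_eq_mul]
  ring

theorem rank_le_of_row_eq_zero {s : ℕ} {M : Matrix (Fin n) (Fin m) 𝔽}
    (h : ∀ (i : Fin n) (j : Fin m), s ≤ (i : ℕ) → M i j = 0) : M.rank ≤ s := by
  classical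
  refine (M.rank_le_card_of_support_subset {i : Fin n | (i : ℕ) < s} ?_).trans ?_
  · intro i hi
    by_contra hi'
    apply hi
    ext j
    exact h i j (by simpa using hi')
  · rw [Fin.card_filter_val_lt]; exact min_le_right _ _

theorem rank_le_of_row_eq_zero' {s : ℕ} {M : Matrix (Fin n) (Fin m) 𝔽}
    (h : ∀ (i : Fin n) (j : Fin m), (i : ℕ) < s → M i j = 0) : M.rank ≤ n - s := by
  classical
  refine (M.rank_le_card_of_support_subset {i : Fin n | ¬ (i : ℕ) < s} ?_).trans ?_
  · intro i hi
    by_contra hi'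
    apply hi
    ext j
    exact h i j (by simpa using hi')
  · have := Finset.card_filter_add_card_filter_not (s := (Finset.univ : Finset (Fin n)))
      (fun i : Fin n => (i : ℕ) < s)
    rw [Fin.card_filter_val_lt] at this
    simp only [Finset.card_univ, Fintype.card_fin] at this
    omega

theorem apply_eq_zero_of_mem_dualCode_zeroOutside {P : Fin n → Fin m → Prop}
    {N : Matrix (Fin n) (Fin m) 𝔽} (hN : N ∈ dualCode (zeroOutside P)) {i : Fin n} {j : Fin m}
    (h : P i j) : N i j = 0 := by
  have h1 := hN (vecMulVec (Pi.single i (1 : 𝔽)) (Pi.single j (1 : 𝔽))) (by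
    intro i' j' h'
    rw [vecMulVec_apply]
    by_cases hi : i' = i
    · by_cases hj : j' = j
      · subst hi hj; exact absurd h h'
      · simp [hj]
    · simp [hi])
  rw [trace_mul_transpose_comm, trace_vecMulVec_mul_transpose] at h1
  simpa using h1

theorem outer_zero (x : Fin n → 𝔽) : vecMulVec x (0 : Fin m → 𝔽) = 0 := by
  ext
  simp [vecMulVec_apply]

open Classical in
/-- The number of pairs `(x, y)` whose outer product lies in the code. -/
noncomputable def outerCount [Fintype 𝔽] (C : Submodule 𝔽 (Matrix (Fin n) (Fin m) 𝔽)) : ℕ :=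
  Finset.card {p : (Fin n → 𝔽) × (Fin m → 𝔽) | vecMulVec p.1 p.2 ∈ C}

/-- The vectors `y` with `x yᵗ ∈ C`. -/
def rightFiber (C : Submodule 𝔽 (Matrix (Fin n) (Fin m) 𝔽)) (x : Fin n → 𝔽) :
    Submodule 𝔽 (Fin m → 𝔽) where
  carrier := {y | vecMulVec x y ∈ C}
  add_mem' := fun {a b} ha hb => by
    have : vecMulVec x (a + b) ∈ C := by rw [vecMulVec_add]; exact C.add_mem ha hb
    exact this
  zero_mem' := by
    have : vecMulVec x (0 : Fin m → 𝔽) ∈ C := by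
      rw [outer_zero]; exact C.zero_mem
    exact this
  smul_mem' := fun c a ha => by
    have : vecMulVec x (c • a) ∈ C := by rw [vecMulVec_smul]; exact C.smul_mem c ha
    exact this

/-- The vectors `x` with `x yᵗ ∈ C`. -/
def leftFiber (C : Submodule 𝔽 (Matrix (Fin n) (Fin m) 𝔽)) (y : Fin m → 𝔽) :
    Submodule 𝔽 (Fin n → 𝔽) where
  carrier := {x | vecMulVec x y ∈ C}
  add_mem' := fun {a b} ha hb => by
    have : vecMulVec (a + b) y ∈ C := by rw [add_vecMulVec]; exact C.add_mem ha hb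
    exact this
  zero_mem' := by
    have : vecMulVec (0 : Fin n → 𝔽) y ∈ C := by rw [zero_vecMulVec]; exact C.zero_mem
    exact this
  smul_mem' := fun c a ha => by
    have : vecMulVec (c • a) y ∈ C := by rw [smul_vecMulVec]; exact C.smul_mem c ha
    exact this

theorem mem_rightFiber {C : Submodule 𝔽 (Matrix (Fin n) (Fin m) 𝔽)} {x : Fin n → 𝔽}
    {y : Fin m → 𝔽} : y ∈ rightFiber C x ↔ vecMulVec x y ∈ C := Iff.rfl

theorem mem_leftFiber {C : Submodule 𝔽 (Matrix (Fin n) (Fin m) 𝔽)} {x : Fin n → 𝔽}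
    {y : Fin m → 𝔽} : x ∈ leftFiber C y ↔ vecMulVec x y ∈ C := Iff.rfl

theorem outerCount_eq_sum_right [Fintype 𝔽] (C : Submodule 𝔽 (Matrix (Fin n) (Fin m) 𝔽)) :
    outerCount C = ∑ x, Fintype.card 𝔽 ^ finrank 𝔽 (rightFiber C x) := by
  classical
  simp only [outerCount, ← card_filter_mem_submodule, mem_rightFiber, Finset.card_filter]
  rw [Fintype.sum_prod_type]

theorem outerCount_eq_sum_left [Fintype 𝔽] (C : Submodule 𝔽 (Matrix (Fin n) (Fin m) 𝔽)) :
    outerCount C = ∑ y, Fintype.card 𝔽 ^ finrank 𝔽 (leftFiber C y) := by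
  classical
  simp only [outerCount, ← card_filter_mem_submodule, mem_leftFiber, Finset.card_filter]
  rw [Fintype.sum_prod_type_right]

theorem outerCount_eq_of_rank_le [Fintype 𝔽] (hnm : n ≤ m) {r : ℕ}
    (hrn : r ≤ n) {C C' : Submodule 𝔽 (Matrix (Fin n) (Fin m) 𝔽)}
    (hCC' : finrank 𝔽 C = finrank 𝔽 C')
    (hC : ∀ M ∈ C, M.rank ≤ r) (hC' : ∀ M ∈ C', M.rank ≤ r)
    (hE : ∀ N ∈ dualCode C, N.rank ≤ n + 1 - r) (hE' : ∀ N ∈ dualCode C', N.rank ≤ n + 1 - r) :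
    outerCount C = outerCount C' := by
  classical
  have h : ∀ C : Submodule 𝔽 (Matrix (Fin n) (Fin m) 𝔽), outerCount C = ∑ M with M ∈ C,
      Finset.card {p : (Fin n → 𝔽) × (Fin m → 𝔽) | vecMulVec p.1 p.2 = M} := by
    intro C
    rw [outerCount, Finset.card_eq_sum_card_fiberwise (f := fun p => vecMulVec p.1 p.2)
      (t := {M | M ∈ C})]
    · refine Finset.sum_congr rfl fun M hM => ?_
      congr 1
      ext p
      simp only [Finset.mem_filter, Finset.mem_univ, true_and] at hM ⊢
      constructor
      · exact fun h => h.2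
      · intro h; exact ⟨h ▸ hM, h⟩
    · intro p hp
      simpa using hp
  rw [h, h]
  refine sum_eq_sum_of_rank_le hnm hrn hCC' hC hC' hE hE' _ ?_
  intro g k M
  symm
  refine Finset.card_bij (fun p _ => (g.1 *ᵥ p.1, p.2 ᵥ* k.1)) ?_ ?_ ?_
  · intro p hp
    simp only [Finset.mem_filter, Finset.mem_univ, true_and] at hp ⊢
    rw [← hp, mul_vecMulVec, vecMulVec_mul]
  · intro p _ p' _ h
    rw [Prod.mk.injEq] at h
    exact Prod.ext (Matrix.mulVec_injective_of_isUnit g.isUnit h.1)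
      (Matrix.vecMul_injective_of_isUnit k.isUnit h.2)
  · intro p hp
    simp only [Finset.mem_filter, Finset.mem_univ, true_and] at hp
    have h1 : g⁻¹.1 * g.1 = 1 := g.inv_mul
    have h2 : k.1 * k⁻¹.1 = 1 := k.mul_inv
    refine ⟨(g⁻¹.1 *ᵥ p.1, p.2 ᵥ* k⁻¹.1), ?_, ?_⟩
    · simp only [Finset.mem_filter, Finset.mem_univ, true_and]
      rw [← mul_vecMulVec, ← vecMulVec_mul, hp, ← Matrix.mul_assoc]
      calc g⁻¹.1 * (g.1 * M * k.1) * k⁻¹.1 = (g⁻¹.1 * g.1) * M * (k.1 * k⁻¹.1) := by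
            simp only [Matrix.mul_assoc]
        _ = M := by rw [h1, h2, Matrix.one_mul, Matrix.mul_one]
    · simp

theorem outerCount_zeroOutside [Fintype 𝔽] {α ρ : ℕ} (hα : α < n) (hρ : ρ ≤ m) :
    outerCount (zeroOutside (fun (i : Fin n) (j : Fin m) =>
      (i : ℕ) < α ∨ ((i : ℕ) < α + 1 ∧ (j : ℕ) < ρ)) : Submodule 𝔽 (Matrix (Fin n) (Fin m) 𝔽)) +
      Fintype.card 𝔽 ^ (α + 1) + Fintype.card 𝔽 ^ (α + ρ) =
    Fintype.card 𝔽 ^ (α + m) + Fintype.card 𝔽 ^ (α + ρ + 1) + Fintype.card 𝔽 ^ n := by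
  classical
  set q := Fintype.card 𝔽
  rw [outerCount_eq_sum_left]
  have h : ∀ y : Fin m → 𝔽, q ^ finrank 𝔽 (leftFiber (zeroOutside
      (fun (i : Fin n) (j : Fin m) => (i : ℕ) < α ∨ ((i : ℕ) < α + 1 ∧ (j : ℕ) < ρ)) :
        Submodule 𝔽 (Matrix (Fin n) (Fin m) 𝔽)) y) + (if y = 0 then q ^ (α + 1) else 0) +
        (if ∀ j : Fin m, ρ ≤ (j : ℕ) → y j = 0 then q ^ α else 0) = 
      q ^ α + (if ∀ j : Fin m, ρ ≤ (j : ℕ) → y j = 0 then q ^ (α + 1) else 0) +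
        (if y = 0 then q ^ n else 0) := by
    intro y
    rw [← card_filter_mem_submodule]
    by_cases hy : y = 0
    · subst hy
      have h0 : ∀ x : Fin n → 𝔽, vecMulVec x (0 : Fin m → 𝔽) = 0 := outer_zero
      simp only [mem_leftFiber, h0, Submodule.zero_mem, Pi.zero_apply]
      simp [q]
      ring
    · obtain ⟨j₀, hj₀⟩ := Function.ne_iff.1 hy
      rw [Pi.zero_apply] at hj₀
      by_cases hy2 : ∀ j : Fin m, ρ ≤ (j : ℕ) → y j = 0
      · rw [if_neg hy, if_pos hy2, if_pos hy2, if_neg hy]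
        rw [show (Finset.univ.filter fun x => x ∈ leftFiber (zeroOutside
          (fun (i : Fin n) (j : Fin m) => (i : ℕ) < α ∨ ((i : ℕ) < α + 1 ∧ (j : ℕ) < ρ)) :
            Submodule 𝔽 (Matrix (Fin n) (Fin m) 𝔽)) y) =
            ({x | ∀ i : Fin n, α + 1 ≤ (i : ℕ) → x i = 0} : Finset _) from ?_,
          card_filter_eq_zero_of_le (by omega)]
        · ring
        ext x
        simp only [Finset.mem_filter, Finset.mem_univ, true_and, mem_leftFiber]
        constructor
        · intro hx i hi
          have := hx i j₀ (by omega)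
          rw [vecMulVec_apply] at this
          exact (mul_eq_zero.1 this).resolve_right hj₀
        · intro hx i j hij
          rw [vecMulVec_apply]
          by_cases hi : α + 1 ≤ (i : ℕ)
          · rw [hx i hi, zero_mul]
          · rw [hy2 j (by omega), mul_zero]
      · rw [if_neg hy, if_neg hy2, if_neg hy2, if_neg hy]
        push Not at hy2
        obtain ⟨j₁, hj₁, hj₁'⟩ := hy2
        rw [show (Finset.univ.filter fun x => x ∈ leftFiber (zeroOutside
          (fun (i : Fin n) (j : Fin m) => (i : ℕ) < α ∨ ((i : ℕ) < α + 1 ∧ (j : ℕ) < ρ)) :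
            Submodule 𝔽 (Matrix (Fin n) (Fin m) 𝔽)) y) =
            ({x | ∀ i : Fin n, α ≤ (i : ℕ) → x i = 0} : Finset _) from ?_,
          card_filter_eq_zero_of_le (by omega)]
        ext x
        simp only [Finset.mem_filter, Finset.mem_univ, true_and, mem_leftFiber]
        constructor
        · intro hx i hi
          have := hx i j₁ (by omega)
          rw [vecMulVec_apply] at this
          exact (mul_eq_zero.1 this).resolve_right hj₁'
        · intro hx i j hij
          rw [vecMulVec_apply, hx i (by omega), zero_mul]
  have h2 := Finset.sum_congr (rfl : (Finset.univ : Finset (Fin m → 𝔽)) = _) fun y _ => h y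
  rw [Finset.sum_add_distrib, Finset.sum_add_distrib, Finset.sum_add_distrib,
    Finset.sum_add_distrib, Finset.sum_ite_eq', Finset.sum_ite_eq', ← Finset.sum_filter,
    ← Finset.sum_filter, Finset.sum_const, Finset.sum_const, Finset.sum_const,
    card_filter_eq_zero_of_le hρ] at h2
  simp only [Finset.mem_univ, if_true, smul_eq_mul, Finset.card_univ, Fintype.card_pi,
    Finset.prod_const, Fintype.card_fin] at h2
  change _ + _ + q ^ ρ * q ^ α = q ^ m * q ^ α + q ^ ρ * q ^ (α + 1) + q ^ n at h2
  rw [pow_add q α ρ, pow_add q α m, show α + ρ + 1 = ρ + (α + 1) by ring, pow_add q ρ,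
    mul_comm (q ^ α), mul_comm (q ^ α)]
  exact h2

theorem rank_le_of_isQOAC {C : Submodule 𝔽 (Matrix (Fin n) (Fin m) 𝔽)} (hC : isQOAC C)
    {a r : ℕ} (hdim : finrank 𝔽 C = a * m + r) (hr0 : 0 < r) (hrm : r < m)
    {M : Matrix (Fin n) (Fin m) 𝔽} (hM : M ∈ C) : M.rank ≤ a + 1 := by
  have h1 : M.rank ≤ maxrk C := by
    refine le_csSup ⟨n, ?_⟩ ⟨M, hM, rfl⟩
    rintro _ ⟨N, -, rfl⟩
    exact N.rank_le_height
  have h2 : ⌈(finrank 𝔽 C : ℚ) / (m : ℚ)⌉ ≤ ((a + 1 : ℕ) : ℤ) := by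
    rw [Int.ceil_le, div_le_iff₀ (by exact_mod_cast (by omega : 0 < m)), hdim]
    have : a * m + r ≤ (a + 1) * m := by
      rw [add_mul]; omega
    exact_mod_cast this
  rw [← hC.2] at h2
  have h3 : maxrk C ≤ a + 1 := by exact_mod_cast h2
  exact h1.trans h3

theorem lt_of_finrank_eq {C : Submodule 𝔽 (Matrix (Fin n) (Fin m) 𝔽)} {α ρ : ℕ}
    (hdim : finrank 𝔽 C = α * m + ρ) (hρ0 : 0 < ρ) : α < n := by
  have h := finrank_code_le C
  rw [hdim] at h
  by_contra h'
  have := Nat.mul_le_mul_right m (not_lt.1 h')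
  omega

theorem outerCount_of_isDuallyQOAC [Fintype 𝔽] (hnm : n ≤ m)
    {C : Submodule 𝔽 (Matrix (Fin n) (Fin m) 𝔽)} (hC : isDuallyQOAC C) {α ρ : ℕ}
    (hdim : finrank 𝔽 C = α * m + ρ) (hρ0 : 0 < ρ) (hρm : ρ < m) :
    outerCount C + Fintype.card 𝔽 ^ (α + 1) + Fintype.card 𝔽 ^ (α + ρ) =
    Fintype.card 𝔽 ^ (α + m) + Fintype.card 𝔽 ^ (α + ρ + 1) + Fintype.card 𝔽 ^ n := by
  have hα := lt_of_finrank_eq hdim hρ0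
  have hE : finrank 𝔽 (dualCode C) = (n - α - 1) * m + (m - ρ) := by
    rw [finrank_dualCode, hdim]
    obtain ⟨d, rfl⟩ := Nat.exists_eq_add_of_lt hα
    rw [show α + d + 1 - α - 1 = d by omega]
    have : (α + d + 1) * m = α * m + d * m + m := by ring
    omega
  rw [← outerCount_zeroOutside hα hρm.le]
  congr 2
  refine outerCount_eq_of_rank_le (r := α + 1) hnm hα ?_ (fun M hM => ?_) (fun M hM => ?_)
    (fun N hN => ?_) (fun N hN => ?_)
  · rw [hdim, finrank_zeroOutside_steps (Nat.le_succ α) hα hρm.le]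
    simp
  · exact rank_le_of_isQOAC hC.1 hdim hρ0 hρm hM
  · refine rank_le_of_row_eq_zero fun i j hi => hM i j ?_
    omega
  · have := rank_le_of_isQOAC hC.2 hE (by omega) (by omega) hN
    omega
  · have : N.rank ≤ n - α := rank_le_of_row_eq_zero' fun i j hi =>
      apply_eq_zero_of_mem_dualCode_zeroOutside hN (Or.inl hi)
    omega

/-- The transposed code. -/
def transposeCode (C : Submodule 𝔽 (Matrix (Fin n) (Fin m) 𝔽)) :
    Submodule 𝔽 (Matrix (Fin m) (Fin n) 𝔽) :=
  C.comap (transposeLinearEquiv (Fin m) (Fin n) 𝔽 𝔽).toLinearMap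

theorem mem_transposeCode {C : Submodule 𝔽 (Matrix (Fin n) (Fin m) 𝔽)}
    {M : Matrix (Fin m) (Fin n) 𝔽} : M ∈ transposeCode C ↔ Mᵀ ∈ C := Iff.rfl

theorem outer_mem_transposeCode {C : Submodule 𝔽 (Matrix (Fin n) (Fin m) 𝔽)}
    {x : Fin n → 𝔽} {y : Fin m → 𝔽} :
    vecMulVec y x ∈ transposeCode C ↔ vecMulVec x y ∈ C := by
  rw [mem_transposeCode, transpose_vecMulVec]

theorem finrank_transposeCode (C : Submodule 𝔽 (Matrix (Fin n) (Fin m) 𝔽)) :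
    finrank 𝔽 (transposeCode C) = finrank 𝔽 C := by
  let e : transposeCode C ≃ₗ[𝔽] C :=
    { toFun := fun M => ⟨M.1ᵀ, M.2⟩
      map_add' := fun _ _ => rfl
      map_smul' := fun _ _ => rfl
      invFun := fun M => ⟨M.1ᵀ, M.2⟩
      left_inv := fun _ => rfl
      right_inv := fun _ => rfl }
  exact e.finrank_eq

theorem outerCount_transposeCode [Fintype 𝔽] (C : Submodule 𝔽 (Matrix (Fin n) (Fin m) 𝔽)) :
    outerCount (transposeCode C) = outerCount C := by
  refine Finset.card_equiv (Equiv.prodComm _ _) fun p => ?_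
  simp [outer_mem_transposeCode]

theorem equivCode_of_transposeCode {C : Submodule 𝔽 (Matrix (Fin n) (Fin n) 𝔽)}
    {D : Submodule 𝔽 (Matrix (Fin n) (Fin n) 𝔽)}
    (h : ∃ (N : Matrix (Fin n) (Fin n) 𝔽) (M : Matrix (Fin n) (Fin n) 𝔽),
      IsUnit N ∧ IsUnit M ∧ ((transposeCode C : Submodule 𝔽 (Matrix (Fin n) (Fin n) 𝔽)) :
        Set (Matrix (Fin n) (Fin n) 𝔽)) =
        (fun A : Matrix (Fin n) (Fin n) 𝔽 => N * A * M) '' (D : Set _)) :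
    equivCode C D := by
  obtain ⟨N, M, hN, hM, h⟩ := h
  refine Or.inr ⟨rfl, Mᵀ, Nᵀ, (isUnit_transpose _).2 hM, (isUnit_transpose _).2 hN, ?_⟩
  ext X
  have hX : X ∈ C ↔ Xᵀ ∈ ((transposeCode C : Submodule 𝔽 (Matrix (Fin n) (Fin n) 𝔽)) :
        Set (Matrix (Fin n) (Fin n) 𝔽)) := Iff.rfl
  rw [SetLike.mem_coe, hX, h]
  refine exists_congr fun A => and_congr_right fun _ => ?_
  have h2 : Mᵀ * (reindex (finCongr rfl) (finCongr rfl) Aᵀ) * Nᵀ = (N * A * M)ᵀ := by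
    rw [transpose_mul, transpose_mul, ← Matrix.mul_assoc]
    rfl
  change N * A * M = Xᵀ ↔ Mᵀ * (reindex (finCongr rfl) (finCongr rfl) Aᵀ) * Nᵀ = X
  rw [h2]
  exact ⟨fun h => by rw [h, transpose_transpose], fun h => by rw [← h, transpose_transpose]⟩

theorem exists_linearIndependent_forall_mem {K V : Type*} [Field K] [AddCommGroup V] [Module K V]
    [FiniteDimensional K V] (S : ℕ → Submodule K V) :
    ∀ (k : ℕ), (∀ i < k, i < finrank K (S i)) →
      ∃ b : Fin k → V, LinearIndependent K b ∧ ∀ i : Fin k, b i ∈ S i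
  | 0, _ => ⟨Fin.elim0, linearIndependent_empty_type, fun i => i.elim0⟩
  | k + 1, h => by
    obtain ⟨b, hb, hbS⟩ := exists_linearIndependent_forall_mem S k fun i hi => h i (by omega)
    have hlt : finrank K (Submodule.span K (Set.range b)) < finrank K (S k) := by
      rw [finrank_span_eq_card hb, Fintype.card_fin]
      exact h k (by omega)
    obtain ⟨v, hv, hvb⟩ : ∃ v ∈ S k, v ∉ Submodule.span K (Set.range b) := by
      by_contra hcon
      push Not at hcon
      exact absurd (Submodule.finrank_mono (show S k ≤ _ from hcon)) (by omega)
    refine ⟨Fin.snoc b v, hb.finSnoc hvb, fun i => ?_⟩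
    refine Fin.lastCases ?_ (fun i => ?_) i
    · simpa using hv
    · simpa using hbS i

theorem exists_basis_of_flag {ℓ u v : ℕ} {U V : Submodule 𝔽 (Fin ℓ → 𝔽)}
    (hu : u ≤ finrank 𝔽 U) (hv : v ≤ finrank 𝔽 V) :
    ∃ b : Fin ℓ → Fin ℓ → 𝔽, LinearIndependent 𝔽 b ∧ (∀ i : Fin ℓ, (i : ℕ) < u → b i ∈ U) ∧
      ∀ i : Fin ℓ, u ≤ (i : ℕ) → (i : ℕ) < v → b i ∈ V := by
  obtain ⟨b, hb, h⟩ := exists_linearIndependent_forall_mem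
    (fun i => if i < u then U else if i < v then V else ⊤) ℓ (by
      intro i hi
      by_cases h1 : i < u
      · rw [if_pos h1]; omega
      · by_cases h2 : i < v
        · rw [if_neg h1, if_pos h2]; omega
        · rw [if_neg h1, if_neg h2]; simpa using hi)
  refine ⟨b, hb, fun i hi => ?_, fun i hi hi' => ?_⟩
  · simpa [hi] using h i
  · simpa [hi.not_gt, hi'] using h i

/-- A code containing `U ⊗ 𝔽^m` and `V ⊗ W` and having the minimal dimension for this is
equivalent to a standard one. -/
theorem equiv_steps {u v w : ℕ} (huv : u ≤ v) (hvn : v ≤ n) (hwm : w ≤ m)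
    {C : Submodule 𝔽 (Matrix (Fin n) (Fin m) 𝔽)} (hC : finrank 𝔽 C = u * m + (v - u) * w)
    {U V : Submodule 𝔽 (Fin n → 𝔽)} {W : Submodule 𝔽 (Fin m → 𝔽)}
    (hu : u ≤ finrank 𝔽 U) (hv : v ≤ finrank 𝔽 V) (hw : w ≤ finrank 𝔽 W)
    (hU : ∀ x ∈ U, ∀ y, vecMulVec x y ∈ C) (hV : ∀ x ∈ V, ∀ y ∈ W, vecMulVec x y ∈ C) :
    ∃ (N : Matrix (Fin n) (Fin n) 𝔽) (M : Matrix (Fin m) (Fin m) 𝔽),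
      IsUnit N ∧ IsUnit M ∧ (C : Set (Matrix (Fin n) (Fin m) 𝔽)) =
        (fun A : Matrix (Fin n) (Fin m) 𝔽 => N * A * M) ''
          (zeroOutside (fun (i : Fin n) (j : Fin m) =>
            (i : ℕ) < u ∨ ((i : ℕ) < v ∧ (j : ℕ) < w)) : Submodule 𝔽 _) := by
  obtain ⟨b, hb, hbU, hbV⟩ := exists_basis_of_flag hu hv
  obtain ⟨c, hc, hcW, -⟩ := exists_basis_of_flag hw hw
  set P := fun (i : Fin n) (j : Fin m) => (i : ℕ) < u ∨ ((i : ℕ) < v ∧ (j : ℕ) < w)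
  have hbc : ∀ i j, P i j → vecMulVec (b i) (c j) ∈ C := by
    rintro i j h
    by_cases hi : (i : ℕ) < u
    · exact hU _ (hbU i hi) _
    · have := h.resolve_left hi
      exact hV _ (hbV i (not_lt.1 hi) this.1) _ (hcW j this.2)
  have hN : IsUnit (Matrix.of b)ᵀ :=
    (isUnit_transpose _).2 (Matrix.linearIndependent_rows_iff_isUnit.1 hb)
  have hM : IsUnit (Matrix.of c) := Matrix.linearIndependent_rows_iff_isUnit.1 hc
  let L : Matrix (Fin n) (Fin m) 𝔽 →ₗ[𝔽] Matrix (Fin n) (Fin m) 𝔽 :=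
    { toFun := fun A => (Matrix.of b)ᵀ * A * Matrix.of c
      map_add' := fun A B => by rw [Matrix.mul_add, Matrix.add_mul]
      map_smul' := fun r A => by simp }
  have hL : Function.Injective L := by
    intro A B h
    have h1 : (Matrix.of b)ᵀ * A * Matrix.of c = (Matrix.of b)ᵀ * B * Matrix.of c := h
    have h2 := mul_left_injective_of_inv _ _
      (mul_nonsing_inv _ ((isUnit_iff_isUnit_det _).1 hM)) h1
    exact mul_right_injective_of_inv _ _
      (nonsing_inv_mul _ ((isUnit_iff_isUnit_det _).1 hN)) h2
  refine ⟨(Matrix.of b)ᵀ, Matrix.of c, hN, hM, ?_⟩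
  have hle : (zeroOutside P).map L ≤ C := by
    rintro _ ⟨A, hA, rfl⟩
    have : L A = ∑ i, ∑ j, A i j • vecMulVec (b i) (c j) := by
      ext k l
      simp only [L, LinearMap.coe_mk, AddHom.coe_mk, Matrix.mul_apply, transpose_apply, of_apply,
        Matrix.sum_apply, Matrix.smul_apply, vecMulVec_apply, Finset.sum_mul, smul_eq_mul]
      rw [Finset.sum_comm]
      refine Finset.sum_congr rfl fun i _ => Finset.sum_congr rfl fun j _ => ?_
      ring
    rw [this]
    refine C.sum_mem fun i _ => C.sum_mem fun j _ => ?_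
    by_cases h : P i j
    · exact C.smul_mem _ (hbc i j h)
    · rw [hA i j h, zero_smul]; exact C.zero_mem
  have heq : (zeroOutside P).map L = C := by
    apply Submodule.eq_of_le_of_finrank_eq hle
    rw [(Submodule.equivMapOfInjective L hL _).symm.finrank_eq, hC,
      finrank_zeroOutside_steps huv hvn hwm]
  rw [← heq]
  rfl

/-- The map sending a matrix `N` of the dual code to the linear map `x ↦ xᵗ N` on `A`. -/
def dualAction (C : Submodule 𝔽 (Matrix (Fin n) (Fin m) 𝔽)) (A : Submodule 𝔽 (Fin n → 𝔽)) :
    dualCode C →ₗ[𝔽] A →ₗ[𝔽] (Fin m → 𝔽) :=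
  LinearMap.mk₂ 𝔽 (fun N x => x.1 ᵥ* N.1)
    (fun _ _ _ => vecMul_add _ _ _) (fun _ _ _ => vecMul_smul _ _ _)
    (fun _ _ _ => add_vecMul _ _ _) (fun _ _ _ => smul_vecMul _ _ _)

theorem dualAction_apply (C : Submodule 𝔽 (Matrix (Fin n) (Fin m) 𝔽))
    (A : Submodule 𝔽 (Fin n → 𝔽)) (N : dualCode C) (x : A) :
    dualAction C A N x = x.1 ᵥ* N.1 := rfl

theorem mem_rightFiber_iff_orthogonal (C : Submodule 𝔽 (Matrix (Fin n) (Fin m) 𝔽))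
    (x : Fin n → 𝔽) (y : Fin m → 𝔽) :
    y ∈ rightFiber C x ↔ ∀ N ∈ dualCode C, (x ᵥ* N) ⬝ᵥ y = 0 := by
  rw [mem_rightFiber]
  conv_lhs => rw [← dualCode_dualCode C]
  refine forall₂_congr fun N _ => ?_
  rw [trace_vecMulVec_mul_transpose]

theorem finrank_ker_dualAction_flip_add (C : Submodule 𝔽 (Matrix (Fin n) (Fin m) 𝔽))
    (A : Submodule 𝔽 (Fin n → 𝔽)) (x : A) :
    finrank 𝔽 (LinearMap.ker ((dualAction C A).flip x)) + m =
      finrank 𝔽 (dualCode C) + finrank 𝔽 (rightFiber C x.1) := by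
  have h1 := LinearMap.finrank_range_add_finrank_ker ((dualAction C A).flip x)
  have h2 : rightFiber C x.1 = LinearMap.BilinForm.orthogonal
      (dotProductBilin 𝔽 𝔽 : LinearMap.BilinForm 𝔽 (Fin m → 𝔽))
      (LinearMap.range ((dualAction C A).flip x)) := by
    ext y
    rw [mem_rightFiber_iff_orthogonal]
    constructor
    · rintro h _ ⟨N, rfl⟩
      exact h N.1 N.2
    · intro h N hN
      exact h _ ⟨⟨N, hN⟩, rfl⟩
  have h3 := LinearMap.BilinForm.finrank_orthogonal (dotProductBilin_nondegenerate 𝔽 m)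
    (LinearMap.range ((dualAction C A).flip x))
  rw [← h2, finrank_fin_fun] at h3
  have h4 := (LinearMap.range ((dualAction C A).flip x)).finrank_le
  rw [finrank_fin_fun] at h4
  omega

open Classical in
theorem sum_card_pow_finrank_ker_dualAction [Fintype 𝔽]
    (C : Submodule 𝔽 (Matrix (Fin n) (Fin m) 𝔽)) (A : Submodule 𝔽 (Fin n → 𝔽)) :
    (∑ N : dualCode C, Fintype.card 𝔽 ^ finrank 𝔽 (LinearMap.ker (dualAction C A N))) *
        Fintype.card 𝔽 ^ m =
      Fintype.card 𝔽 ^ finrank 𝔽 (dualCode C) *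
        ∑ x with x ∈ A, Fintype.card 𝔽 ^ finrank 𝔽 (rightFiber C x) := by
  have h1 : ∑ N : dualCode C, Fintype.card 𝔽 ^ finrank 𝔽 (LinearMap.ker (dualAction C A N)) =
      ∑ x : A, Fintype.card 𝔽 ^ finrank 𝔽 (LinearMap.ker ((dualAction C A).flip x)) := by
    simp only [← card_filter_mem_submodule, Finset.card_filter, LinearMap.mem_ker,
      LinearMap.flip_apply]
    rw [Finset.sum_comm]
  rw [h1, Finset.sum_mul, Finset.mul_sum, Finset.sum_subtype (p := (· ∈ A)) _ (by simp)]
  refine Finset.sum_congr rfl fun x _ => ?_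
  rw [← pow_add, ← pow_add, finrank_ker_dualAction_flip_add]

open Classical in
theorem sum_right_le [Fintype 𝔽]
    (C : Submodule 𝔽 (Matrix (Fin n) (Fin m) 𝔽)) (A : Submodule 𝔽 (Fin n → 𝔽)) {q e z s : ℕ}
    (hq : Fintype.card 𝔽 = q) (he : finrank 𝔽 (dualCode C) = e)
    (hz : finrank 𝔽 (LinearMap.ker (dualAction C A)) = z) (hs : finrank 𝔽 A = s) :
    q ^ (e + 1) * (∑ x with x ∈ A, q ^ finrank 𝔽 (rightFiber C x)) + q ^ (m + z + s) ≤
        q ^ (m + z + s + 1) + q ^ (m + e + s) ∧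
      (q ^ (e + 1) * (∑ x with x ∈ A, q ^ finrank 𝔽 (rightFiber C x)) + q ^ (m + z + s) =
        q ^ (m + z + s + 1) + q ^ (m + e + s) →
        ∀ N, finrank 𝔽 (LinearMap.range (dualAction C A N)) ≤ 1) := by
  have hq1 : 1 < q := hq ▸ Fintype.one_lt_card
  let κ : dualCode C → ℕ := fun N => finrank 𝔽 (LinearMap.ker (dualAction C A N))
  have hκ : ∀ N, finrank 𝔽 (LinearMap.range (dualAction C A N)) + κ N = s := fun N =>
    (LinearMap.finrank_range_add_finrank_ker _).trans hs
  have hterm : ∀ N, q ^ (κ N + 1) + (if N ∈ LinearMap.ker (dualAction C A) then q ^ s else 0) ≤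
      (if N ∈ LinearMap.ker (dualAction C A) then q ^ (s + 1) else 0) + q ^ s := by
    intro N
    have := hκ N
    split_ifs with h
    · gcongr <;> omega
    · have h0 : finrank 𝔽 (LinearMap.range (dualAction C A N)) ≠ 0 := by
        intro h0
        exact h (LinearMap.range_eq_bot.1 (Submodule.finrank_eq_zero.1 h0))
      rw [add_zero, zero_add]
      exact Nat.pow_le_pow_right hq1.le (by omega)
  have hsum := sum_card_pow_finrank_ker_dualAction C A
  rw [he, hq] at hsum
  have hL : ∑ N, (q ^ (κ N + 1) +
      (if N ∈ LinearMap.ker (dualAction C A) then q ^ s else 0)) =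
      q * (∑ N, q ^ κ N) + q ^ z * q ^ s := by
    rw [Finset.sum_add_distrib, ← Finset.sum_filter, Finset.sum_const,
      card_filter_mem_submodule, hz, hq, smul_eq_mul, Finset.mul_sum]
    simp only [pow_succ, mul_comm]
  have hcardE : Fintype.card (dualCode C) = q ^ e := by
    rw [Module.card_eq_pow_finrank (K := 𝔽), he, hq]
  have hR : ∑ N, ((if N ∈ LinearMap.ker (dualAction C A) then q ^ (s + 1) else 0) + q ^ s) =
      q ^ z * q ^ (s + 1) + q ^ e * q ^ s := by
    rw [Finset.sum_add_distrib, ← Finset.sum_filter, Finset.sum_const, Finset.sum_const,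
      card_filter_mem_submodule, hz, hq, smul_eq_mul, smul_eq_mul, Finset.card_univ, hcardE]
  have e1 : q ^ (e + 1) * (∑ x with x ∈ A, q ^ finrank 𝔽 (rightFiber C x)) + q ^ (m + z + s) =
      q ^ m * ∑ N, (q ^ (κ N + 1) +
        (if N ∈ LinearMap.ker (dualAction C A) then q ^ s else 0)) := by
    rw [hL, pow_succ, mul_right_comm, ← hsum]
    ring
  have e2 : q ^ (m + z + s + 1) + q ^ (m + e + s) = q ^ m *
      ∑ N, ((if N ∈ LinearMap.ker (dualAction C A) then q ^ (s + 1) else 0) + q ^ s) := by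
    rw [hR]
    ring
  rw [e1, e2]
  refine ⟨Nat.mul_le_mul_left _ (Finset.sum_le_sum fun N _ => hterm N), fun h N => ?_⟩
  have h1 := Nat.eq_of_mul_eq_mul_left (Nat.pow_pos (by omega)) h
  have h2 := (Finset.sum_eq_sum_iff_of_le fun N _ => hterm N).1 h1 N (Finset.mem_univ _)
  have h3 := hκ N
  by_cases hN : N ∈ LinearMap.ker (dualAction C A)
  · rw [LinearMap.mem_ker.1 hN, LinearMap.range_zero, finrank_bot]
    omega
  · rw [if_neg hN, if_neg hN, add_zero, zero_add] at h2
    have := Nat.pow_right_injective hq1 h2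
    omega

theorem forall_outer_mem_iff_ker_dualAction (C : Submodule 𝔽 (Matrix (Fin n) (Fin m) 𝔽))
    (A : Submodule 𝔽 (Fin n → 𝔽)) :
    (∀ x ∈ A, ∀ y, vecMulVec x y ∈ C) ↔
      finrank 𝔽 (LinearMap.ker (dualAction C A)) = finrank 𝔽 (dualCode C) := by
  constructor
  · intro h
    have : LinearMap.ker (dualAction C A) = ⊤ := by
      rw [LinearMap.ker_eq_top]
      ext N x
      have := (mem_rightFiber_iff_orthogonal C x.1 (Pi.single ‹_› 1)).1 (h x.1 x.2 _) N.1 N.2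
      simpa [dualAction_apply] using this
    rw [this, finrank_top]
  · intro h x hx y
    have h2 := LinearMap.ker_eq_top.1 (Submodule.eq_top_of_finrank_eq h)
    rw [← mem_rightFiber, mem_rightFiber_iff_orthogonal]
    intro N hN
    have : dualAction C A ⟨N, hN⟩ ⟨x, hx⟩ = 0 := by rw [h2]; rfl
    rw [dualAction_apply] at this
    rw [this, zero_dotProduct]

open Classical in
theorem sum_right_le_of_not_forall_mem [Fintype 𝔽]
    (C : Submodule 𝔽 (Matrix (Fin n) (Fin m) 𝔽)) (A : Submodule 𝔽 (Fin n → 𝔽)) {q s : ℕ}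
    (hq : Fintype.card 𝔽 = q) (hs : finrank 𝔽 A = s)
    (hA : ¬ ∀ x ∈ A, ∀ y, vecMulVec x y ∈ C) :
    q ^ 2 * (∑ x with x ∈ A, q ^ finrank 𝔽 (rightFiber C x)) + q ^ (m + s) ≤
      2 * q ^ (m + s + 1) := by
  have hq1 : 1 < q := hq ▸ Fintype.one_lt_card
  have h := (sum_right_le C A hq rfl rfl hs).1
  rw [forall_outer_mem_iff_ker_dualAction] at hA
  have hle := (LinearMap.ker (dualAction C A)).finrank_le
  set z := finrank 𝔽 (LinearMap.ker (dualAction C A))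
  set e := finrank 𝔽 (dualCode C)
  set S := ∑ x with x ∈ A, q ^ finrank 𝔽 (rightFiber C x)
  obtain ⟨d, hd⟩ : ∃ d, e = z + 1 + d := Nat.exists_eq_add_of_le (by omega)
  have h1 : (1 : ℕ) ≤ q ^ d := Nat.one_le_pow _ _ (by omega)
  have hz : 0 < q ^ (z + 1 + d) := Nat.pow_pos (by omega)
  refine Nat.le_of_mul_le_mul_left ?_ hz
  rw [hd] at h
  obtain ⟨p, rfl⟩ : ∃ p, q = p + 1 := ⟨q - 1, by omega⟩
  set q := p + 1
  have h2 : p * q ^ (m + z + s + 1) * 1 ≤ p * q ^ (m + z + s + 1) * q ^ d :=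
    Nat.mul_le_mul_left _ h1
  have h3 := Nat.mul_le_mul_left q h
  have e1 : q * (q ^ (z + 1 + d + 1) * S + q ^ (m + z + s)) =
    q ^ (z + 1 + d) * (q ^ 2 * S) + q ^ (m + z + s + 1) := by ring
  have e2 : q * (q ^ (m + z + s + 1) + q ^ (m + (z + 1 + d) + s)) =
    p * q ^ (m + z + s + 1) + q ^ (m + z + s + 1) + q ^ (z + 1 + d) * q ^ (m + s + 1) := by
    simp only [q]; ring
  have e3 : p * q ^ (m + z + s + 1) * q ^ d + q ^ (z + 1 + d) * q ^ (m + s) =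
      q ^ (z + 1 + d) * q ^ (m + s + 1) := by
    simp only [q]; ring
  rw [e1, e2] at h3
  rw [Nat.mul_add]
  linarith

theorem finrank_ker_dualAction_le (C : Submodule 𝔽 (Matrix (Fin n) (Fin m) 𝔽))
    (A : Submodule 𝔽 (Fin n → 𝔽)) :
    finrank 𝔽 (LinearMap.ker (dualAction C A)) ≤ m * (n - finrank 𝔽 A) := by
  set W := LinearMap.BilinForm.orthogonal
    (dotProductBilin 𝔽 𝔽 : LinearMap.BilinForm 𝔽 (Fin n → 𝔽)) A
  have hW : finrank 𝔽 W = n - finrank 𝔽 A := by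
    have := LinearMap.BilinForm.finrank_orthogonal (dotProductBilin_nondegenerate 𝔽 n) A
    rwa [finrank_fin_fun] at this
  rw [← hW, ← finrank_matCol (m := m) W]
  have hmem : ∀ N ∈ LinearMap.ker (dualAction C A), (dualCode C).subtype N ∈ matCol W := by
    intro N hN j x hx
    have : dualAction C A N ⟨x, hx⟩ = 0 := by rw [LinearMap.mem_ker.1 hN]; rfl
    exact congrFun this j
  refine LinearMap.finrank_le_finrank_of_injective
    (f := (dualCode C).subtype.restrict hmem) ?_
  intro x y h
  apply Subtype.ext
  apply Subtype.ext
  have h' := congrArg Subtype.val h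
  exact h'

theorem Submodule.exists_ge_finrank_eq {K V : Type*} [Field K] [AddCommGroup V] [Module K V]
    [FiniteDimensional K V] (S : Submodule K V) {d : ℕ} (hd : d ≤ finrank K S) :
    ∃ T ≤ S, finrank K T = d := by
  obtain ⟨U, -, hU⟩ := (⊥ : Submodule K S).exists_le_finrank_eq d (by simp) hd
  exact ⟨U.map S.subtype, S.map_subtype_le U, by rw [Submodule.finrank_map_subtype_eq, hU]⟩

theorem apply_mem_span_of_finrank_range_le_one {K V W : Type*} [Field K] [AddCommGroup V]
    [Module K V] [AddCommGroup W] [Module K W] [FiniteDimensional K W] {g : V →ₗ[K] W}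
    (hg : finrank K (LinearMap.range g) ≤ 1) {x : V} (hx : g x ≠ 0) (x' : V) :
    g x' ∈ Submodule.span K {g x} := by
  have h : Submodule.span K {g x} = LinearMap.range g := by
    apply Submodule.eq_of_le_of_finrank_le
    · rw [Submodule.span_singleton_le_iff_mem]; exact ⟨x, rfl⟩
    · rwa [finrank_span_singleton hx]
  rw [h]
  exact ⟨x', rfl⟩

/-- A linear space of maps of rank at most one either has a common image line or a common kernel
hyperplane. -/
theorem common_image_or_kernel_of_finrank_range_le_one {K E V W : Type*} [Field K]
    [AddCommGroup E] [Module K E] [AddCommGroup V] [Module K V] [FiniteDimensional K V]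
    [AddCommGroup W] [Module K W] [FiniteDimensional K W]
    (L : E →ₗ[K] V →ₗ[K] W) (hL : ∀ N, finrank K (LinearMap.range (L N)) ≤ 1) :
    (∃ w, ∀ N x, L N x ∈ Submodule.span K {w}) ∨
      ∃ H : Submodule K V, finrank K V ≤ finrank K H + 1 ∧ ∀ N, ∀ x ∈ H, L N x = 0 := by
  by_cases h0 : ∀ N x, L N x = 0
  · exact Or.inl ⟨0, fun N x => by rw [h0]; exact Submodule.zero_mem _⟩
  push Not at h0
  obtain ⟨N₁, x₁, hx₁⟩ := h0
  have key : ∀ N x₂, L N x₂ ∉ Submodule.span K {L N₁ x₁} → ∀ x, L N₁ x = 0 → L N x = 0 := by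
    intro N x₂ hx₂ x hx
    by_contra hne
    apply hx₂
    have h1 := apply_mem_span_of_finrank_range_le_one (hL N) hne x₁
    have h2 : (L (N₁ + N)) x = L N x := by rw [map_add, LinearMap.add_apply, hx, zero_add]
    have h3 := apply_mem_span_of_finrank_range_le_one (hL (N₁ + N)) (h2 ▸ hne) x₁
    rw [h2, map_add, LinearMap.add_apply] at h3
    have h4 : L N₁ x₁ ∈ Submodule.span K {L N x} := by
      simpa using Submodule.sub_mem _ h3 h1
    obtain ⟨c, hc⟩ := Submodule.mem_span_singleton.1 h4
    have hc0 : c ≠ 0 := by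
      rintro rfl
      exact hx₁ (by rw [← hc, zero_smul])
    have h5 : L N x ∈ Submodule.span K {L N₁ x₁} := by
      refine Submodule.mem_span_singleton.2 ⟨c⁻¹, ?_⟩
      rw [← hc, inv_smul_smul₀ hc0]
    exact (Submodule.span_singleton_le_iff_mem _ _).2 h5
      (apply_mem_span_of_finrank_range_le_one (hL N) hne x₂)
  by_cases h1 : ∀ N x, L N x ∈ Submodule.span K {L N₁ x₁}
  · exact Or.inl ⟨_, h1⟩
  push Not at h1
  obtain ⟨N₂, x₂, hx₂⟩ := h1
  refine Or.inr ⟨LinearMap.ker (L N₁), ?_, fun N x hx => ?_⟩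
  · rw [← LinearMap.finrank_range_add_finrank_ker (L N₁)]
    have := hL N₁
    omega
  · have h2 := key N₂ x₂ hx₂ x hx
    by_cases h3 : L N x₂ ∈ Submodule.span K {L N₁ x₁}
    · have h4 := key (N₂ + N) x₂ (fun h => hx₂ (by
        rw [map_add, LinearMap.add_apply] at h
        simpa using Submodule.sub_mem _ h h3)) x hx
      rwa [map_add, LinearMap.add_apply, h2, zero_add] at h4
    · exact key N x₂ h3 x hx

theorem pow_succ_add_cancel {q x y : ℕ} (hq : 1 < q)
    (h : q ^ (x + 1) + q ^ y = q ^ (y + 1) + q ^ x) :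
    x = y := by
  obtain ⟨p, rfl⟩ : ∃ p, q = p + 1 := ⟨q - 1, by omega⟩
  have h1 : p * (p + 1) ^ x = p * (p + 1) ^ y := by
    rw [pow_succ, pow_succ] at h
    linarith
  exact Nat.pow_right_injective hq (Nat.eq_of_mul_eq_mul_left (by omega) h1)

open Classical in
theorem sum_filter_mem_split [Fintype 𝔽] {U A : Submodule 𝔽 (Fin n → 𝔽)} (h : U ≤ A)
    (f : (Fin n → 𝔽) → ℕ) :
    ∑ x with x ∈ A, f x = ∑ x with x ∈ U, f x + ∑ x with x ∈ A ∧ x ∉ U, f x := by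
  rw [← Finset.sum_filter_add_sum_filter_not _ (· ∈ U), Finset.filter_filter, Finset.filter_filter]
  congr 2
  ext x
  simp only [Finset.mem_filter, Finset.mem_univ, true_and]
  exact ⟨fun hx => hx.2, fun hx => ⟨h hx, hx⟩⟩

open Classical in
theorem card_filter_mem_diff [Fintype 𝔽] {U A : Submodule 𝔽 (Fin n → 𝔽)} (h : U ≤ A) :
    Finset.card {x | x ∈ A ∧ x ∉ U} + Fintype.card 𝔽 ^ finrank 𝔽 U =
      Fintype.card 𝔽 ^ finrank 𝔽 A := by
  have := sum_filter_mem_split h (fun _ => 1)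
  simp only [← Finset.card_eq_sum_ones, card_filter_mem_submodule] at this
  omega

open Classical in
theorem outerCount_split [Fintype 𝔽] (C : Submodule 𝔽 (Matrix (Fin n) (Fin m) 𝔽))
    (A : Submodule 𝔽 (Fin n → 𝔽)) :
    outerCount C = ∑ x with x ∈ A, Fintype.card 𝔽 ^ finrank 𝔽 (rightFiber C x) +
      ∑ x with x ∉ A, Fintype.card 𝔽 ^ finrank 𝔽 (rightFiber C x) := by
  rw [outerCount_eq_sum_right, Finset.sum_filter_add_sum_filter_not]

open Classical in
theorem card_filter_notMem [Fintype 𝔽] (U : Submodule 𝔽 (Fin n → 𝔽)) :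
    Finset.card {x | x ∉ U} + Fintype.card 𝔽 ^ finrank 𝔽 U = Fintype.card 𝔽 ^ n := by
  have := card_filter_mem_diff (le_top (a := U))
  simpa using this

/-- `C` is the image of the standard code with `u` full rows, followed by rows up to the `v`-th
supported on the first `w` entries, under a two-sided multiplication by invertible matrices. -/
def IsStepCode (C : Submodule 𝔽 (Matrix (Fin n) (Fin m) 𝔽)) (u v w : ℕ) : Prop :=
  ∃ (N : Matrix (Fin n) (Fin n) 𝔽) (M : Matrix (Fin m) (Fin m) 𝔽),
    IsUnit N ∧ IsUnit M ∧ (C : Set (Matrix (Fin n) (Fin m) 𝔽)) =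
      (fun A : Matrix (Fin n) (Fin m) 𝔽 => N * A * M) ''
        (zeroOutside (fun (i : Fin n) (j : Fin m) =>
          (i : ℕ) < u ∨ ((i : ℕ) < v ∧ (j : ℕ) < w)) : Submodule 𝔽 _)

theorem isStepCode_of_common_kernel [Fintype 𝔽] {q α ρ : ℕ} (hq : Fintype.card 𝔽 = q)
    (hρ0 : 0 < ρ) (hρm : ρ < m) (hα : α < n)
    {C : Submodule 𝔽 (Matrix (Fin n) (Fin m) 𝔽)} (hdim : finrank 𝔽 C = α * m + ρ)
    {U A : Submodule 𝔽 (Fin n → 𝔽)} (hUA : U ≤ A) (hU : finrank 𝔽 U = α)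
    (hA : finrank 𝔽 A = α + 1) (hUC : ∀ x ∈ U, ∀ y, vecMulVec x y ∈ C)
    (hsum : (open Classical in ∑ x with x ∈ A, q ^ finrank 𝔽 (rightFiber C x)) + q ^ (α + ρ) =
      q ^ (α + m) + q ^ (α + ρ + 1)) : IsStepCode C α (α + 1) ρ := by
  classical
  have hq1 : 1 < q := hq ▸ Fintype.one_lt_card
  obtain ⟨x₀, hx₀A, hx₀U, hx₀⟩ : ∃ x₀ ∈ A, x₀ ∉ U ∧ ρ ≤ finrank 𝔽 (rightFiber C x₀) := by
    by_contra hcon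
    push Not at hcon
    have h1 : ∑ x with x ∈ U, q ^ finrank 𝔽 (rightFiber C x) ≤ q ^ α * q ^ m := by
      rw [← hU, ← hq, ← card_filter_mem_submodule, hq, ← smul_eq_mul]
      refine Finset.sum_le_card_nsmul _ _ _ fun x _ => Nat.pow_le_pow_right hq1.le ?_
      simpa using (rightFiber C x).finrank_le
    have h2 : ∑ x with x ∈ A ∧ x ∉ U, q ^ finrank 𝔽 (rightFiber C x) ≤
        Finset.card {x | x ∈ A ∧ x ∉ U} * q ^ (ρ - 1) := by
      rw [← smul_eq_mul]
      refine Finset.sum_le_card_nsmul _ _ _ fun x hx => Nat.pow_le_pow_right hq1.le ?_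
      simp only [Finset.mem_filter, Finset.mem_univ, true_and] at hx
      have := hcon x hx.1 hx.2
      omega
    have h3 := card_filter_mem_diff hUA
    rw [hU, hA, hq] at h3
    rw [sum_filter_mem_split hUA] at hsum
    obtain ⟨r, rfl⟩ : ∃ r, ρ = r + 1 := ⟨ρ - 1, by omega⟩
    rw [Nat.add_sub_cancel] at h2
    have h4 : (Finset.card {x | x ∈ A ∧ x ∉ U} + q ^ α) * q ^ r = q ^ (α + 1) * q ^ r := by
      rw [h3]
    have h5 : q ^ (α + r + 1) < q ^ (α + r + 1 + 1) := Nat.pow_lt_pow_right hq1 (by omega)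
    have e1 : q ^ (α + 1) * q ^ r = q ^ (α + r + 1) := by ring
    have e2 : q ^ α * q ^ m = q ^ (α + m) := by ring
    have h6 : 0 < q ^ α * q ^ r := by positivity
    have h7 : 2 * q ^ (α + r + 1) ≤ q ^ (α + r + 1 + 1) := by
      rw [pow_succ q (α + r + 1), mul_comm]; exact Nat.mul_le_mul_left _ hq1
    rw [← add_assoc α r 1] at hsum
    linarith
  have hsup : α + 1 ≤ finrank 𝔽 (U ⊔ Submodule.span 𝔽 {x₀} : Submodule 𝔽 (Fin n → 𝔽)) := by
    rw [← hU, Nat.succ_le_iff]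
    refine Submodule.finrank_lt_finrank_of_lt (lt_of_le_of_ne le_sup_left fun h => hx₀U ?_)
    rw [h]
    exact Submodule.mem_sup_right (Submodule.mem_span_singleton_self x₀)
  refine equiv_steps (Nat.le_succ α) hα hρm.le (by rw [hdim]; simp) hU.ge hsup hx₀ hUC ?_
  intro x hx y hy
  have hle : U ⊔ Submodule.span 𝔽 {x₀} ≤ leftFiber C y :=
    sup_le (fun x hx => hUC x hx y) ((Submodule.span_singleton_le_iff_mem _ _).2 hy)
  exact hle hx

theorem isStepCode_of_common_image [Fintype 𝔽] {q α ρ : ℕ} (hq : Fintype.card 𝔽 = q)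
    (hρ0 : 0 < ρ) (hρm : ρ < m) (hα : α < n)
    {C : Submodule 𝔽 (Matrix (Fin n) (Fin m) 𝔽)} (hdim : finrank 𝔽 C = α * m + ρ)
    {A : Submodule 𝔽 (Fin n → 𝔽)} (hA : finrank 𝔽 A = α + 1)
    {W : Submodule 𝔽 (Fin m → 𝔽)} (hW : m ≤ finrank 𝔽 W + 1)
    (hWC : ∀ x ∈ A, ∀ y ∈ W, vecMulVec x y ∈ C)
    (hsum : (open Classical in ∑ x with x ∈ A, q ^ finrank 𝔽 (rightFiber C x)) + q ^ (α + ρ) =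
      q ^ (α + m) + q ^ (α + ρ + 1)) :
    m - α - 1 ≤ ρ ∧ IsStepCode C (α + ρ + 1 - m) (α + 1) (m - 1) := by
  classical
  have hq1 : 1 < q := hq ▸ Fintype.one_lt_card
  set U : Submodule 𝔽 (Fin n → 𝔽) := A ⊓ ⨅ y, leftFiber C y
  have hUC : ∀ x ∈ U, ∀ y, vecMulVec x y ∈ C := fun x hx y => (Submodule.mem_iInf _).1 hx.2 y
  have hUA : U ≤ A := inf_le_left
  obtain ⟨a, ha⟩ : ∃ a, finrank 𝔽 U = a := ⟨_, rfl⟩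
  have h1 : ∑ x with x ∈ U, q ^ finrank 𝔽 (rightFiber C x) = q ^ a * q ^ m := by
    rw [← ha, ← hq, ← card_filter_mem_submodule, hq, ← smul_eq_mul]
    refine Finset.sum_eq_card_nsmul fun x hx => ?_
    have : rightFiber C x = ⊤ := by
      rw [eq_top_iff]
      intro y _
      exact hUC x (by simpa using hx) y
    rw [this, finrank_top, finrank_fin_fun]
  have h2 : ∑ x with x ∈ A ∧ x ∉ U, q ^ finrank 𝔽 (rightFiber C x) =
      Finset.card {x | x ∈ A ∧ x ∉ U} * q ^ (m - 1) := by
    rw [← smul_eq_mul]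
    refine Finset.sum_eq_card_nsmul fun x hx => ?_
    simp only [Finset.mem_filter, Finset.mem_univ, true_and] at hx
    have h3 : W ≤ rightFiber C x := fun y hy => hWC x hx.1 y hy
    have h4 := Submodule.finrank_mono h3
    have h5 : finrank 𝔽 (rightFiber C x) < m := by
      by_contra hcon
      apply hx.2
      refine ⟨hx.1, (Submodule.mem_iInf _).2 fun y => ?_⟩
      have h6 : rightFiber C x = ⊤ := Submodule.eq_top_of_finrank_eq
        (le_antisymm (Submodule.finrank_le _) (by simpa using hcon))
      have h7 : y ∈ rightFiber C x := by rw [h6]; trivial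
      exact h7
    rw [show finrank 𝔽 (rightFiber C x) = m - 1 by omega]
  have h3 := card_filter_mem_diff hUA
  rw [ha, hA, hq] at h3
  rw [sum_filter_mem_split hUA, h1, h2] at hsum
  obtain ⟨k, rfl⟩ : ∃ k, m = k + 1 := ⟨m - 1, by omega⟩
  rw [Nat.add_sub_cancel] at hsum ⊢
  have h4 : (Finset.card {x | x ∈ A ∧ x ∉ U} + q ^ a) * q ^ k = q ^ (α + 1) * q ^ k := by
    rw [h3]
  have h5 : a + k = α + ρ := by
    refine pow_succ_add_cancel hq1 ?_
    have e1 : q ^ (α + 1) * q ^ k = q ^ (α + (k + 1)) := by ring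
    have e2 : q ^ a * q ^ (k + 1) = q ^ (a + k + 1) := by ring
    have e3 : q ^ a * q ^ k = q ^ (a + k) := by ring
    linarith
  refine ⟨by omega, ?_⟩
  rw [show α + ρ + 1 - (k + 1) = a by omega]
  have h6 := Submodule.finrank_mono hUA
  rw [ha, hA] at h6
  refine equiv_steps h6 hα (by omega) ?_ ha.ge hA.ge (by omega) hUC hWC
  rw [hdim]
  obtain ⟨d, hd⟩ := Nat.exists_eq_add_of_le h6
  rw [hd, Nat.add_sub_cancel_left]
  have e1 : ρ + d = k + 1 := by omega
  have e2 : α + 1 = a + d := hd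
  have e3 : (α + 1) * (k + 1) = (a + d) * (k + 1) := by rw [e2]
  linarith

theorem isStepCode_of_cover_left [Fintype 𝔽] {q α ρ : ℕ} (hq : Fintype.card 𝔽 = q)
    (hρ0 : 0 < ρ) (hρm : ρ < m) (hα : α < n)
    {C : Submodule 𝔽 (Matrix (Fin n) (Fin m) 𝔽)} (hdim : finrank 𝔽 C = α * m + ρ)
    (hcount : outerCount C + q ^ (α + 1) + q ^ (α + ρ) =
      q ^ (α + m) + q ^ (α + ρ + 1) + q ^ n)
    {A : Submodule 𝔽 (Fin n → 𝔽)} (hA : finrank 𝔽 A = α + 1)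
    (hcover : ∀ x y, vecMulVec x y ∈ C → x ∈ A ∨ y = 0) :
    IsStepCode C α (α + 1) ρ ∨
      (m - α - 1 ≤ ρ ∧ IsStepCode C (α + ρ + 1 - m) (α + 1) (m - 1)) := by
  classical
  have hq1 : 1 < q := hq ▸ Fintype.one_lt_card
  have hsum : ∑ x with x ∈ A, q ^ finrank 𝔽 (rightFiber C x) + q ^ (α + ρ) =
      q ^ (α + m) + q ^ (α + ρ + 1) := by
    have h1 : ∑ x with x ∉ A, q ^ finrank 𝔽 (rightFiber C x) = Finset.card {x | x ∉ A} * 1 := by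
      rw [← smul_eq_mul]
      refine Finset.sum_eq_card_nsmul fun x hx => ?_
      have : rightFiber C x = ⊥ := by
        rw [eq_bot_iff]
        intro y hy
        exact (hcover x y hy).resolve_left (by simpa using hx)
      rw [this, finrank_bot, pow_zero]
    have h2 := card_filter_notMem A
    rw [hA, hq] at h2
    rw [outerCount_split C A, hq, h1] at hcount
    omega
  obtain ⟨z, hz⟩ : ∃ z, finrank 𝔽 (LinearMap.ker (dualAction C A)) = z := ⟨_, rfl⟩
  obtain ⟨e, he⟩ : ∃ e, finrank 𝔽 (dualCode C) = e := ⟨_, rfl⟩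
  obtain ⟨hle, heq⟩ := sum_right_le C A hq he hz hA
  have hze : z + m ≤ e + ρ := by
    have h1 := finrank_ker_dualAction_le C A
    have h2 := finrank_dualCode C
    rw [hz, hA] at h1
    rw [he, hdim] at h2
    obtain ⟨d, rfl⟩ := Nat.exists_eq_add_of_lt hα
    rw [show α + d + 1 - (α + 1) = d by omega] at h1
    have : (α + d + 1) * m = α * m + m * d + m := by ring
    omega
  have hrk := heq (le_antisymm hle (by
    obtain ⟨p, hp⟩ : ∃ p, q = p + 1 := ⟨q - 1, by omega⟩
    have hG : q ^ (m + z + (α + 1)) ≤ q ^ (e + 1 + (α + ρ)) :=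
      Nat.pow_le_pow_right hq1.le (by omega)
    have h1 := Nat.mul_le_mul_left p hG
    have h2 := congrArg (q ^ (e + 1) * ·) hsum
    simp only [mul_add] at h2
    have e1 : q ^ (m + z + (α + 1) + 1) =
        p * q ^ (m + z + (α + 1)) + q ^ (m + z + (α + 1)) := by
      rw [pow_succ]; nth_rewrite 2 [hp]; ring
    have e2 : q ^ (e + 1) * q ^ (α + ρ + 1) =
        p * q ^ (e + 1 + (α + ρ)) + q ^ (e + 1 + (α + ρ)) := by
      rw [← pow_add, ← add_assoc (e + 1), pow_succ]; nth_rewrite 2 [hp]; ring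
    have e3 : q ^ (e + 1) * q ^ (α + ρ) = q ^ (e + 1 + (α + ρ)) := by rw [← pow_add]
    have e4 : q ^ (e + 1) * q ^ (α + m) = q ^ (m + e + (α + 1)) := by ring
    linarith))
  rcases common_image_or_kernel_of_finrank_range_le_one _ hrk with ⟨w, hw⟩ | ⟨H, hH, hHC⟩
  · right
    refine isStepCode_of_common_image hq hρ0 hρm hα hdim hA
      (W := LinearMap.BilinForm.orthogonal
        (dotProductBilin 𝔽 𝔽 : LinearMap.BilinForm 𝔽 (Fin m → 𝔽)) (Submodule.span 𝔽 {w})) ?_ ?_ hsum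
    · rw [LinearMap.BilinForm.finrank_orthogonal (dotProductBilin_nondegenerate 𝔽 m),
        finrank_fin_fun]
      have := finrank_span_le_card (R := 𝔽) ({w} : Set (Fin m → 𝔽))
      simp only [Set.toFinset_singleton, Finset.card_singleton] at this
      omega
    · intro x hx y hy
      rw [← mem_rightFiber, mem_rightFiber_iff_orthogonal]
      intro N hN
      exact hy _ (hw ⟨N, hN⟩ ⟨x, hx⟩)
  · left
    obtain ⟨T, hTH, hT⟩ := H.exists_ge_finrank_eq (d := α) (by omega)
    refine isStepCode_of_common_kernel hq hρ0 hρm hα hdim (U := T.map A.subtype)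
      (A.map_subtype_le T) (by rw [Submodule.finrank_map_subtype_eq, hT]) hA ?_ hsum
    rintro _ ⟨x, hx, rfl⟩ y
    rw [← mem_rightFiber, mem_rightFiber_iff_orthogonal]
    intro N hN
    have := hHC ⟨N, hN⟩ x (hTH hx)
    rw [dualAction_apply] at this
    rw [Submodule.subtype_apply, this, zero_dotProduct]

theorem rightFiber_eq_top_of_forall_mem {C : Submodule 𝔽 (Matrix (Fin n) (Fin m) 𝔽)}
    {x : Fin n → 𝔽} (h : ∀ y, vecMulVec x y ∈ C) : rightFiber C x = ⊤ := by
  rw [eq_top_iff]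
  exact fun y _ => h y

open Classical in
theorem sum_right_eq_of_forall_mem [Fintype 𝔽]
    {C : Submodule 𝔽 (Matrix (Fin n) (Fin m) 𝔽)} {A : Submodule 𝔽 (Fin n → 𝔽)}
    (h : ∀ x ∈ A, ∀ y, vecMulVec x y ∈ C) :
    ∑ x with x ∈ A, Fintype.card 𝔽 ^ finrank 𝔽 (rightFiber C x) =
      Fintype.card 𝔽 ^ (finrank 𝔽 A + m) := by
  rw [pow_add, ← card_filter_mem_submodule, ← smul_eq_mul]
  refine Finset.sum_eq_card_nsmul fun x hx => ?_
  rw [rightFiber_eq_top_of_forall_mem (h x (by simpa using hx)), finrank_top, finrank_fin_fun]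

theorem finrank_rightFiber_of_le_span {C : Submodule 𝔽 (Matrix (Fin n) (Fin m) 𝔽)}
    {y₀ : Fin m → 𝔽} (hy₀ : y₀ ≠ 0) {x : Fin n → 𝔽}
    (h : ∀ y, vecMulVec x y ∈ C → y ∈ Submodule.span 𝔽 {y₀}) [Decidable (x ∈ leftFiber C y₀)] :
    finrank 𝔽 (rightFiber C x) = if x ∈ leftFiber C y₀ then 1 else 0 := by
  have hle : rightFiber C x ≤ Submodule.span 𝔽 {y₀} := h
  split_ifs with hx
  · have : rightFiber C x = Submodule.span 𝔽 {y₀} :=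
      le_antisymm hle ((Submodule.span_singleton_le_iff_mem _ _).2 hx)
    rw [this, finrank_span_singleton hy₀]
  · rw [Submodule.finrank_eq_zero, eq_bot_iff]
    intro y hy
    obtain ⟨c, rfl⟩ := Submodule.mem_span_singleton.1 (hle hy)
    by_cases hc : c = 0
    · simp [hc]
    · exact absurd ((Submodule.smul_mem_iff _ hc).1 hy) hx

open Classical in
theorem sum_notMem_of_cover_line [Fintype 𝔽] {q : ℕ} (hq : Fintype.card 𝔽 = q)
    {C : Submodule 𝔽 (Matrix (Fin n) (Fin m) 𝔽)} {A : Submodule 𝔽 (Fin n → 𝔽)}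
    {y₀ : Fin m → 𝔽} (hy₀ : y₀ ≠ 0)
    (hcover : ∀ x y, vecMulVec x y ∈ C → x ∈ A ∨ y ∈ Submodule.span 𝔽 {y₀}) :
    ∑ x with x ∉ A, q ^ finrank 𝔽 (rightFiber C x) +
      ∑ x with x ∈ A, q ^ (if x ∈ leftFiber C y₀ then 1 else 0) +
        q ^ finrank 𝔽 (leftFiber C y₀) = q ^ (finrank 𝔽 (leftFiber C y₀) + 1) + q ^ n := by
  have h1 : ∑ x with x ∉ A, q ^ finrank 𝔽 (rightFiber C x) =
      ∑ x with x ∉ A, q ^ (if x ∈ leftFiber C y₀ then 1 else 0) := by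
    refine Finset.sum_congr rfl fun x hx => ?_
    rw [finrank_rightFiber_of_le_span hy₀ fun y hy =>
      (hcover x y hy).resolve_left (by simpa using hx)]
  rw [h1, add_comm (∑ x with x ∉ A, _), Finset.sum_filter_add_sum_filter_not,
    ← Finset.sum_filter_add_sum_filter_not _ (· ∈ leftFiber C y₀)]
  have h2 : ∑ x with x ∈ leftFiber C y₀, q ^ (if x ∈ leftFiber C y₀ then 1 else 0) =
      Finset.card {x | x ∈ leftFiber C y₀} * q := by
    rw [← smul_eq_mul]
    refine Finset.sum_eq_card_nsmul fun x hx => ?_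
    rw [if_pos (by simpa using hx), pow_one]
  have h3 : ∑ x with x ∉ leftFiber C y₀, q ^ (if x ∈ leftFiber C y₀ then 1 else 0) =
      Finset.card {x | x ∉ leftFiber C y₀} * 1 := by
    rw [← smul_eq_mul]
    refine Finset.sum_eq_card_nsmul fun x hx => ?_
    rw [if_neg (by simpa using hx), pow_zero]
  have h4 := card_filter_notMem (leftFiber C y₀)
  rw [h2, h3, card_filter_mem_submodule, hq, pow_succ]
  rw [hq] at h4
  omega

theorem isStepCode_of_cover_line [Fintype 𝔽] {q α ρ : ℕ} (hq : Fintype.card 𝔽 = q) (hm : 0 < m)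
    {C : Submodule 𝔽 (Matrix (Fin n) (Fin m) 𝔽)} (hdim : finrank 𝔽 C = α * m + ρ)
    (hcount : outerCount C + q ^ (α + 1) + q ^ (α + ρ) =
      q ^ (α + m) + q ^ (α + ρ + 1) + q ^ n)
    {A : Submodule 𝔽 (Fin n → 𝔽)} (hA : finrank 𝔽 A = α) {y₀ : Fin m → 𝔽} (hy₀ : y₀ ≠ 0)
    (hcover : ∀ x y, vecMulVec x y ∈ C → x ∈ A ∨ y ∈ Submodule.span 𝔽 {y₀})
    (hAC : ∀ x ∈ A, ∀ y, vecMulVec x y ∈ C) :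
    α + ρ ≤ n ∧ IsStepCode C α (α + ρ) 1 := by
  classical
  have hq1 : 1 < q := hq ▸ Fintype.one_lt_card
  have h1 := sum_notMem_of_cover_line hq hy₀ hcover
  have h2 := sum_right_eq_of_forall_mem hAC
  have h3 : ∑ x with x ∈ A, q ^ (if x ∈ leftFiber C y₀ then 1 else 0) = q ^ (α + 1) := by
    rw [pow_succ, ← hA, ← hq, ← card_filter_mem_submodule, ← smul_eq_mul]
    refine Finset.sum_eq_card_nsmul fun x hx => ?_
    rw [if_pos (mem_leftFiber.2 (hAC x (by simpa using hx) _)), pow_one]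
  rw [outerCount_split C A, hq] at hcount
  rw [hq, hA] at h2
  have h4 : finrank 𝔽 (leftFiber C y₀) = α + ρ := by
    refine pow_succ_add_cancel hq1 ?_
    omega
  have h5 : α + ρ ≤ n := by
    simpa [h4] using (leftFiber C y₀).finrank_le
  refine ⟨h5, equiv_steps (Nat.le_add_right _ _) h5 hm (by rw [hdim]; simp) hA.ge h4.ge
    (finrank_span_singleton hy₀).ge hAC fun x hx y hy => ?_⟩
  exact (Submodule.span_singleton_le_iff_mem _ (rightFiber C x)).2 hx hy

theorem eq_one_of_cover_line_of_not_forall_mem [Fintype 𝔽] {q α ρ : ℕ}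
    (hq : Fintype.card 𝔽 = q) (hρ0 : 0 < ρ) (hnm : n ≤ m)
    {C : Submodule 𝔽 (Matrix (Fin n) (Fin m) 𝔽)}
    (hcount : outerCount C + q ^ (α + 1) + q ^ (α + ρ) =
      q ^ (α + m) + q ^ (α + ρ + 1) + q ^ n)
    {A : Submodule 𝔽 (Fin n → 𝔽)} (hA : finrank 𝔽 A = α) {y₀ : Fin m → 𝔽} (hy₀ : y₀ ≠ 0)
    (hcover : ∀ x y, vecMulVec x y ∈ C → x ∈ A ∨ y ∈ Submodule.span 𝔽 {y₀})
    (hAC : ¬ ∀ x ∈ A, ∀ y, vecMulVec x y ∈ C) :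
    α = 1 ∧ n = m ∧ ∀ x, vecMulVec x y₀ ∈ C := by
  classical
  have hq1 : 1 < q := hq ▸ Fintype.one_lt_card
  have hα : 1 ≤ α := by
    by_contra h
    refine hAC fun x hx y => ?_
    have hbot : A = ⊥ := Submodule.finrank_eq_zero.1 (by omega)
    rw [hbot, Submodule.mem_bot] at hx
    rw [hx, zero_vecMulVec]
    exact C.zero_mem
  have h1 := sum_notMem_of_cover_line hq hy₀ hcover
  have h2 := sum_right_le_of_not_forall_mem C A hq hA hAC
  have h3 : q ^ α ≤ ∑ x with x ∈ A, q ^ (if x ∈ leftFiber C y₀ then 1 else 0) := by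
    rw [← hA, ← hq, ← card_filter_mem_submodule, Finset.card_eq_sum_ones]
    exact Finset.sum_le_sum fun x _ => Nat.one_le_pow _ _ Fintype.card_pos
  rw [outerCount_split C A, hq] at hcount
  have hen : finrank 𝔽 (leftFiber C y₀) ≤ n := by simpa using (leftFiber C y₀).finrank_le
  have key : m + α ≤ finrank 𝔽 (leftFiber C y₀) + 1 := by
    by_contra hlt
    generalize finrank 𝔽 (leftFiber C y₀) = e at *
    generalize (∑ x with x ∈ A, q ^ finrank 𝔽 (rightFiber C x)) = P at *
    obtain ⟨y, hy⟩ : ∃ y, m + α = y + 1 := ⟨m + α - 1, by omega⟩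
    have hRK : q ^ α < q ^ (α + ρ) := Nat.pow_lt_pow_right hq1 (by omega)
    have hYe : q ^ (e + 1) ≤ q ^ y := Nat.pow_le_pow_right hq1.le (by omega)
    rw [add_comm α m, hy] at hcount
    rw [hy] at h2
    obtain ⟨p, rfl⟩ : ∃ p, q = p + 2 := ⟨q - 2, by omega⟩
    simp only [pow_succ _ α, pow_succ _ (α + ρ), pow_succ _ y, pow_succ _ (y + 1),
      pow_succ _ e] at *
    generalize (p + 2) ^ α = K at *
    generalize (p + 2) ^ (α + ρ) = R at *
    generalize (p + 2) ^ y = Y at *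
    generalize (p + 2) ^ e = b at *
    have h4 : Y * (p + 2) + R * (p + 1) ≤ P + b * (p + 1) + K * (p + 1) := by linarith
    have h5 : (p + 2) * P + Y ≤ 2 * (Y * (p + 2)) :=
      Nat.le_of_mul_le_mul_left (by linarith) (show 0 < p + 2 by omega)
    have h6 : (p + 1) * Y + (p + 2) * R ≤ (p + 2) * (b + K) := by
      refine Nat.le_of_mul_le_mul_left ?_ (show 0 < p + 1 by omega)
      have := Nat.mul_le_mul_left (p + 2) h4
      linarith
    have h7 : (p + 2) * K < (p + 2) * R := Nat.mul_lt_mul_of_pos_left hRK (by omega)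
    have h8 : 0 ≤ p * Y := Nat.zero_le _
    linarith
  refine ⟨by omega, by omega, fun x => ?_⟩
  have htop : leftFiber C y₀ = ⊤ := Submodule.eq_top_of_finrank_eq (by
    rw [finrank_fin_fun]; omega)
  have : x ∈ leftFiber C y₀ := by rw [htop]; trivial
  exact this

theorem le_or_le_of_cover [Fintype 𝔽] {q α ρ a b : ℕ} (hq : Fintype.card 𝔽 = q)
    {C : Submodule 𝔽 (Matrix (Fin n) (Fin m) 𝔽)}
    (hcount : outerCount C + q ^ (α + 1) + q ^ (α + ρ) =
      q ^ (α + m) + q ^ (α + ρ + 1) + q ^ n)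
    {A : Submodule 𝔽 (Fin n → 𝔽)} (hA : finrank 𝔽 A = a)
    {B : Submodule 𝔽 (Fin m → 𝔽)} (hB : finrank 𝔽 B = b) (hab : a + b = α + 1)
    (hcover : ∀ x y, vecMulVec x y ∈ C → x ∈ A ∨ y ∈ B) : α ≤ a ∨ α + m ≤ n + b := by
  classical
  have hq1 : 1 < q := hq ▸ Fintype.one_lt_card
  by_contra! hcon
  have h1 : ∑ x with x ∈ A, q ^ finrank 𝔽 (rightFiber C x) ≤ q ^ a * q ^ m := by
    rw [← hA, ← hq, ← card_filter_mem_submodule, hq, ← smul_eq_mul]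
    refine Finset.sum_le_card_nsmul _ _ _ fun x _ => Nat.pow_le_pow_right hq1.le ?_
    simpa using (rightFiber C x).finrank_le
  have h2 : ∑ x with x ∉ A, q ^ finrank 𝔽 (rightFiber C x) ≤
      Finset.card {x | x ∉ A} * q ^ b := by
    rw [← smul_eq_mul]
    refine Finset.sum_le_card_nsmul _ _ _ fun x hx => Nat.pow_le_pow_right hq1.le ?_
    rw [← hB]
    exact Submodule.finrank_mono fun y hy =>
      (hcover x y hy).resolve_left (by simpa using hx)
  have h3 := congrArg (· * q ^ b) (card_filter_notMem A)
  simp only [add_mul, hA, hq, ← pow_add, hab] at h3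
  rw [outerCount_split C A, hq] at hcount
  rw [← pow_add] at h1
  obtain ⟨k, hk⟩ : ∃ k, α + m = k + 1 := ⟨α + m - 1, by omega⟩
  have h4 : q ^ (a + m) ≤ q ^ k := Nat.pow_le_pow_right hq1.le (by omega)
  have h5 : q ^ (n + b) ≤ q ^ k := Nat.pow_le_pow_right hq1.le (by omega)
  have h6 : q ^ (α + ρ) < q ^ (α + ρ + 1) := Nat.pow_lt_pow_right hq1 (by omega)
  have h7 : q ^ k * 2 ≤ q ^ (α + m) := by
    rw [hk, pow_succ]; exact Nat.mul_le_mul_left _ hq1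
  omega

theorem isStepCode_of_cover_right [Fintype 𝔽] {q α ρ : ℕ} (hq : Fintype.card 𝔽 = q)
    (hα1 : 1 ≤ α) (hα : α < n) {C : Submodule 𝔽 (Matrix (Fin n) (Fin (n + 1)) 𝔽)}
    (hdim : finrank 𝔽 C = α * (n + 1) + ρ)
    (hcount : outerCount C + q ^ (α + 1) + q ^ (α + ρ) =
      q ^ (α + (n + 1)) + q ^ (α + ρ + 1) + q ^ n)
    {B : Submodule 𝔽 (Fin (n + 1) → 𝔽)} (hB : finrank 𝔽 B = α + 1)
    (hcover : ∀ x y, vecMulVec x y ∈ C → x = 0 ∨ y ∈ B) :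
    ρ = n - α ∧ IsStepCode C 0 n (α + 1) := by
  classical
  have hq1 : 1 < q := hq ▸ Fintype.one_lt_card
  have h1 : ∑ y with y ∉ B, q ^ finrank 𝔽 (rightFiber (transposeCode C) y) =
      Finset.card {y | y ∉ B} * 1 := by
    rw [← smul_eq_mul]
    refine Finset.sum_eq_card_nsmul fun y hy => ?_
    have : rightFiber (transposeCode C) y = ⊥ := by
      rw [eq_bot_iff]
      intro x hx
      exact (hcover x y (outer_mem_transposeCode.1 hx)).resolve_right (by simpa using hy)
    rw [this, finrank_bot, pow_zero]
  have h2 := card_filter_notMem B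
  rw [← outerCount_transposeCode, outerCount_split _ B, hq, h1] at hcount
  rw [hB, hq] at h2
  have h3 : ∑ y with y ∈ B, q ^ finrank 𝔽 (rightFiber (transposeCode C) y) + q ^ (n + 1) +
      q ^ (α + ρ) = q ^ (α + (n + 1)) + q ^ (α + ρ + 1) + q ^ n := by omega
  by_cases hBC : ∀ y ∈ B, ∀ x, vecMulVec y x ∈ transposeCode C
  · have h4 := sum_right_eq_of_forall_mem hBC
    rw [hq, hB] at h4
    have h5 : n = α + ρ := by
      refine pow_succ_add_cancel hq1 ?_
      rw [h4, show α + 1 + n = α + (n + 1) by omega] at h3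
      omega
    refine ⟨by omega, equiv_steps (Nat.zero_le n) le_rfl (by omega) ?_ (Nat.zero_le _)
      (V := ⊤) (U := ⊥) (by simp) hB.ge ?_ ?_⟩
    · rw [hdim, Nat.sub_zero, zero_mul, zero_add, h5]
      ring
    · intro x hx y
      rw [Submodule.mem_bot] at hx
      rw [hx, zero_vecMulVec]
      exact C.zero_mem
    · exact fun x _ y hy => outer_mem_transposeCode.1 (hBC y hy x)
  · exfalso
    have h4 := sum_right_le_of_not_forall_mem _ B hq hB hBC
    generalize (∑ y with y ∈ B, q ^ finrank 𝔽 (rightFiber (transposeCode C) y)) = P at *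
    have hY : q ^ (n + 1) ≤ q ^ (n + α) := Nat.pow_le_pow_right hq1.le (by omega)
    have hR : 0 < q ^ (α + ρ) := Nat.pow_pos (by omega)
    rw [show α + (n + 1) = n + α + 1 by omega] at h3
    rw [← add_assoc] at h4
    obtain ⟨p, rfl⟩ : ∃ p, q = p + 2 := ⟨q - 2, by omega⟩
    simp only [pow_succ _ n, pow_succ _ (α + ρ), pow_succ _ (n + α),
      pow_succ _ (n + α + 1)] at h3 h4 hY
    generalize (p + 2) ^ (α + ρ) = R at *
    generalize (p + 2) ^ (n + α) = Y at *
    generalize (p + 2) ^ n = Z at *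
    have h5 : (p + 2) * P + Y ≤ 2 * (Y * (p + 2)) :=
      Nat.le_of_mul_le_mul_left (by linarith) (show 0 < p + 2 by omega)
    have h6 : (p + 1) * Y + (p + 2) * R ≤ (p + 2) * Z := by
      refine Nat.le_of_mul_le_mul_left ?_ (show 0 < p + 1 by omega)
      have := congrArg ((p + 2) * ·) h3
      linarith
    have h7 : 0 < (p + 2) * R := Nat.mul_pos (by omega) hR
    have h8 : 0 ≤ p * Y := Nat.zero_le _
    linarith

theorem rank_transpose_mul_of_linearIndependent {l : ℕ} {V : Matrix (Fin l) (Fin n) 𝔽}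
    {W : Matrix (Fin l) (Fin m) 𝔽} (hV : LinearIndependent 𝔽 V.row)
    (hW : LinearIndependent 𝔽 W.row) : (Vᵀ * W).rank = l := by
  have hWtop : LinearMap.range W.mulVecLin = ⊤ := by
    apply Submodule.eq_top_of_finrank_eq
    rw [finrank_fin_fun]
    exact (hW.rank_matrix).trans (Fintype.card_fin l)
  rw [Matrix.rank, mulVecLin_mul, LinearMap.range_comp_of_range_eq_top _ hWtop]
  exact (V.rank_transpose).trans (hV.rank_matrix.trans (Fintype.card_fin l))

/-- The rank-one matrices of a code whose ranks are at most `r` are covered by a space of column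
vectors and a space of row vectors with total dimension at most `r`. -/
theorem exists_cover_of_rank_le [Finite 𝔽] {C : Submodule 𝔽 (Matrix (Fin n) (Fin m) 𝔽)} {r : ℕ}
    (hC : ∀ M ∈ C, M.rank ≤ r) :
    ∃ (A : Submodule 𝔽 (Fin n → 𝔽)) (B : Submodule 𝔽 (Fin m → 𝔽)),
      finrank 𝔽 A + finrank 𝔽 B ≤ r ∧ ∀ x y, vecMulVec x y ∈ C → x ∈ A ∨ y ∈ B := by
  obtain ⟨l, v, w, A, B, hvw, hv, hw, hAB, hl⟩ := exists_indep_pairs_of_cover (K := 𝔽) _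
    {p : (Fin n → 𝔽) × (Fin m → 𝔽) | vecMulVec p.1 p.2 ∈ C} (Set.toFinite _) le_rfl
  refine ⟨A, B, hl.trans ?_, fun x y h => hAB (x, y) h⟩
  rw [← rank_transpose_mul_of_linearIndependent (V := Matrix.of v) (W := Matrix.of w) hv hw]
  apply hC
  have : (Matrix.of v)ᵀ * Matrix.of w = ∑ i, vecMulVec (v i) (w i) := by
    ext i j
    simp [Matrix.mul_apply, Matrix.sum_apply, vecMulVec_apply]
  rw [this]
  exact C.sum_mem fun i _ => hvw i

theorem exists_eq_span_singleton_of_finrank_eq_one {K V : Type*} [Field K] [AddCommGroup V]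
    [Module K V] {B : Submodule K V} (hB : finrank K B = 1) :
    ∃ y ≠ 0, B = Submodule.span K {y} := by
  obtain ⟨v, hv, h⟩ := finrank_eq_one_iff'.1 hB
  refine ⟨v, fun h0 => hv (Subtype.ext h0), le_antisymm (fun w hw => ?_)
    ((Submodule.span_singleton_le_iff_mem _ _).2 v.2)⟩
  obtain ⟨c, hc⟩ := h ⟨w, hw⟩
  exact Submodule.mem_span_singleton.2 ⟨c, congrArg Subtype.val hc⟩

theorem zeroOutside_congr {P Q : Fin n → Fin m → Prop} (h : ∀ i j, P i j ↔ Q i j) :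
    (zeroOutside P : Submodule 𝔽 (Matrix (Fin n) (Fin m) 𝔽)) = zeroOutside Q := by
  rw [show P = Q from funext fun i => funext fun j => propext (h i j)]

theorem IsStepCode.equivCode {C : Submodule 𝔽 (Matrix (Fin n) (Fin m) 𝔽)} {u v w : ℕ}
    (h : IsStepCode C u v w) {P : Fin n → Fin m → Prop}
    (hP : ∀ (i : Fin n) (j : Fin m), ((i : ℕ) < u ∨ ((i : ℕ) < v ∧ (j : ℕ) < w)) ↔ P i j) :
    equivCode C (zeroOutside P) := by
  rw [← zeroOutside_congr hP]
  exact Or.inl h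

theorem IsStepCode.equivCode_transpose {C : Submodule 𝔽 (Matrix (Fin n) (Fin n) 𝔽)} {u v w : ℕ}
    (h : IsStepCode (transposeCode C) u v w) {P : Fin n → Fin n → Prop}
    (hP : ∀ (i : Fin n) (j : Fin n), ((i : ℕ) < u ∨ ((i : ℕ) < v ∧ (j : ℕ) < w)) ↔ P i j) :
    _root_.equivCode C (zeroOutside P) := by
  rw [← zeroOutside_congr hP]
  exact equivCode_of_transposeCode h

end

/-- Structure theorem for dually qOACs. -/
theorem stmt3 {𝔽 : Type*} [Field 𝔽] [Fintype 𝔽] {n m α ρ : ℕ} (hn : 1 ≤ n) (hnm : n ≤ m)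
    (C : Submodule 𝔽 (Matrix (Fin n) (Fin m) 𝔽)) (hC : isDuallyQOAC C)
    (hdim : Module.finrank 𝔽 C = α * m + ρ) (hρ0 : 0 < ρ) (hρm : ρ < m) :
    -- (a) first α rows arbitrary, row α+1 arbitrary in first ρ entries, rest zero
    equivCode C (zeroOutside (fun (i : Fin n) (j : Fin m) =>
        (i : ℕ) < α ∨ ((i : ℕ) = α ∧ (j : ℕ) < ρ))) ∨
    -- (b) first α rows arbitrary, rows α+1,…,α+ρ arbitrary in first entry, rest zero
    (ρ ≤ n - α ∧ equivCode C (zeroOutside (fun (i : Fin n) (j : Fin m) =>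
        (i : ℕ) < α ∨ ((i : ℕ) < α + ρ ∧ (j : ℕ) = 0)))) ∨
    -- (c) first α+ρ+1−m rows arbitrary, rows α+ρ+2−m,…,α+1 arbitrary in first m−1 entries
    (m - α - 1 ≤ ρ ∧ equivCode C (zeroOutside (fun (i : Fin n) (j : Fin m) =>
        (i : ℕ) < α + ρ + 1 - m ∨ ((i : ℕ) ≤ α ∧ (j : ℕ) < m - 1)))) ∨
    -- (d) m = n+1, ρ = n−α, first α+1 columns arbitrary, last n−α columns zero
    (m = n + 1 ∧ ρ = n - α ∧ equivCode C (zeroOutside (fun (_ : Fin n) (j : Fin m) =>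
        (j : ℕ) < α + 1))) := by
  have hα := lt_of_finrank_eq hdim hρ0
  have hcount := outerCount_of_isDuallyQOAC hnm hC hdim hρ0 hρm
  have hPa : ∀ (i : Fin n) (j : Fin m), ((i : ℕ) < α ∨ ((i : ℕ) < α + 1 ∧ (j : ℕ) < ρ)) ↔
      ((i : ℕ) < α ∨ ((i : ℕ) = α ∧ (j : ℕ) < ρ)) := by omega
  have hPb : ∀ (i : Fin n) (j : Fin m), ((i : ℕ) < α ∨ ((i : ℕ) < α + ρ ∧ (j : ℕ) < 1)) ↔
      ((i : ℕ) < α ∨ ((i : ℕ) < α + ρ ∧ (j : ℕ) = 0)) := by omega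
  have hPc : ∀ (i : Fin n) (j : Fin m),
      ((i : ℕ) < α + ρ + 1 - m ∨ ((i : ℕ) < α + 1 ∧ (j : ℕ) < m - 1)) ↔
      ((i : ℕ) < α + ρ + 1 - m ∨ ((i : ℕ) ≤ α ∧ (j : ℕ) < m - 1)) := by omega
  obtain ⟨A₀, B, hAB, hcover₀⟩ :=
    exists_cover_of_rank_le fun M hM => rank_le_of_isQOAC hC.1 hdim hρ0 hρm hM
  obtain ⟨A, hA₀, hA⟩ := A₀.exists_le_finrank_eq (α + 1 - Module.finrank 𝔽 B) (by omega)
    (by rw [Module.finrank_fin_fun]; omega)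
  have hcover : ∀ x y, vecMulVec x y ∈ C → x ∈ A ∨ y ∈ B := fun x y h =>
    (hcover₀ x y h).imp_left fun hx => hA₀ hx
  obtain ⟨b, hB⟩ : ∃ b, Module.finrank 𝔽 B = b := ⟨_, rfl⟩
  rw [hB] at hA hAB
  rcases Nat.lt_trichotomy b 1 with hb | rfl | hb
  · obtain rfl : b = 0 := by omega
    rcases isStepCode_of_cover_left rfl hρ0 hρm hα hdim hcount hA (fun x y h =>
      (hcover x y h).imp_right fun hy => by
        rwa [Submodule.finrank_eq_zero.1 hB, Submodule.mem_bot] at hy) with h | ⟨hρ, h⟩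
    · exact Or.inl (h.equivCode hPa)
    · exact Or.inr (Or.inr (Or.inl ⟨hρ, h.equivCode hPc⟩))
  · obtain ⟨y₀, hy₀, rfl⟩ := exists_eq_span_singleton_of_finrank_eq_one hB
    by_cases hAC : ∀ x ∈ A, ∀ y, vecMulVec x y ∈ C
    · obtain ⟨hρ, h⟩ := isStepCode_of_cover_line rfl (by omega) hdim hcount hA hy₀ hcover hAC
      exact Or.inr (Or.inl ⟨by omega, h.equivCode hPb⟩)
    · obtain ⟨rfl, rfl, hC₀⟩ :=
        eq_one_of_cover_line_of_not_forall_mem rfl hρ0 hnm hcount hA hy₀ hcover hAC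
      obtain ⟨x₀, hx₀, rfl⟩ := exists_eq_span_singleton_of_finrank_eq_one hA
      obtain ⟨hρ, h⟩ := isStepCode_of_cover_line (C := transposeCode C) rfl (by omega)
        ((finrank_transposeCode C).trans hdim) (by rwa [outerCount_transposeCode]) hB hx₀
        (fun y x h => (hcover x y (outer_mem_transposeCode.1 h)).symm)
        (fun y hy x => outer_mem_transposeCode.2 ((Submodule.span_singleton_le_iff_mem _
          (rightFiber C x)).2 (hC₀ x) hy))
      exact Or.inr (Or.inl ⟨by omega, h.equivCode_transpose hPb⟩)
  · have hle := le_or_le_of_cover rfl hcount hA hB (by omega) hcover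
    obtain ⟨a, ha⟩ : ∃ a, α + 1 - b = a := ⟨_, rfl⟩
    rw [ha] at hA hle
    rcases Nat.eq_or_lt_of_le hnm with rfl | hlt
    · rcases Nat.eq_zero_or_pos a with rfl | ha0
      · rcases isStepCode_of_cover_left (C := transposeCode C) rfl hρ0 hρm hα
          ((finrank_transposeCode C).trans hdim) (by rwa [outerCount_transposeCode])
          (hB.trans (by omega)) (fun y x h =>
            (hcover x y (outer_mem_transposeCode.1 h)).symm.imp_right fun hx => by
              rwa [Submodule.finrank_eq_zero.1 hA, Submodule.mem_bot] at hx) with h | ⟨hρ, h⟩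
        · exact Or.inl (h.equivCode_transpose hPa)
        · exact Or.inr (Or.inr (Or.inl ⟨hρ, h.equivCode_transpose hPc⟩))
      · obtain ⟨x₀, hx₀, rfl⟩ :=
          exists_eq_span_singleton_of_finrank_eq_one (hA.trans (by omega : a = 1))
        have hcount' := hcount
        rw [← outerCount_transposeCode] at hcount'
        have hcover' : ∀ y x, vecMulVec y x ∈ transposeCode C →
            y ∈ B ∨ x ∈ Submodule.span 𝔽 {x₀} := fun y x h =>
          (hcover x y (outer_mem_transposeCode.1 h)).symm
        have hBα : Module.finrank 𝔽 B = α := by omega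
        by_cases hBC : ∀ y ∈ B, ∀ x, vecMulVec y x ∈ transposeCode C
        · obtain ⟨hρ, h⟩ := isStepCode_of_cover_line rfl (by omega)
            ((finrank_transposeCode C).trans hdim) hcount' hBα hx₀ hcover' hBC
          exact Or.inr (Or.inl ⟨by omega, h.equivCode_transpose hPb⟩)
        · have := (eq_one_of_cover_line_of_not_forall_mem rfl hρ0 le_rfl hcount' hBα hx₀
            hcover' hBC).1
          omega
    · obtain rfl : m = n + 1 := by omega
      obtain rfl : a = 0 := by omega
      obtain ⟨hρ, h⟩ := isStepCode_of_cover_right rfl (by omega) hα hdim hcount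
        (hB.trans (by omega)) (fun x y h => (hcover x y h).imp_left fun hx => by
          rwa [Submodule.finrank_eq_zero.1 hA, Submodule.mem_bot] at hx)
      exact Or.inr (Or.inr (Or.inr ⟨rfl, hρ, h.equivCode (by omega)⟩))
end

section
/- Let 0 ≤ α < n ≤ m and 0 < ρ < m. The code C ⊆ F_q^{n×m} of all matrices whose first α rows are arbitrary, whose row α+1 is arbitrary in the first ρ entries and zero in the last m−ρ entries, and whose remaining n−α−1 rows are zero, satisfies dim(C) = αm + ρ, maxrk(C) = α+1, and maxrk(C^⊥) = n−α; in particular C is a dually qOAC. -/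
open Matrix

/-- A code whose support lies in the rows `S`, and which contains a partial permutation pattern
meeting every row of `S`, has maximum rank `S.card`. -/
theorem maxrk_zeroOutside {𝔽 : Type*} [Field 𝔽] {n m : ℕ} (P : Fin n → Fin m → Prop)
    (S : Finset (Fin n)) (f : Fin n → Fin m) (hS : ∀ i j, P i j → i ∈ S)
    (hf : ∀ i ∈ S, P i (f i)) (hinj : Set.InjOn f S) :
    maxrk (zeroOutside (𝔽 := 𝔽) P) = S.card := by
  classical
  let D : Matrix (Fin n) (Fin n) 𝔽 := Matrix.diagonal fun i => if i ∈ S then 1 else 0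
  have hD : D.rank = S.card := by
    rw [Matrix.rank_diagonal, Fintype.card_subtype]
    congr 1
    ext i
    simp
  have hub : ∀ M ∈ zeroOutside (𝔽 := 𝔽) P, M.rank ≤ S.card := by
    intro M hM
    have hDM : D * M = M := by
      ext i j
      rw [Matrix.diagonal_mul]
      by_cases hi : i ∈ S
      · simp [hi]
      · simp [hi, hM i j fun h => hi (hS i j h)]
    rw [← hD, ← hDM]
    exact Matrix.rank_mul_le_left D M
  let W : Matrix (Fin n) (Fin m) 𝔽 := Matrix.of fun i j => if i ∈ S ∧ j = f i then 1 else 0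
  have hW : W ∈ zeroOutside (𝔽 := 𝔽) P := by
    intro i j hij
    have : ¬ (i ∈ S ∧ j = f i) := by
      rintro ⟨hi, rfl⟩
      exact hij (hf i hi)
    simp [W, this]
  have hWW : W * Wᵀ = D := by
    ext i k
    simp only [Matrix.mul_apply, Matrix.transpose_apply, W, D, Matrix.of_apply,
      Matrix.diagonal_apply]
    rw [Finset.sum_eq_single (f i)]
    · by_cases hi : i ∈ S
      · by_cases hk : k ∈ S
        · have : f i = f k ↔ i = k := hinj.eq_iff hi hk
          simp [hi, hk, this]
        · have : i ≠ k := by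
            rintro rfl
            exact hk hi
          simp [hk, this]
      · simp [hi]
    · intro j _ hj
      simp [hj]
    · simp
  have hWr : W.rank = S.card := by
    refine le_antisymm (hub W hW) ?_
    rw [← hD, ← hWW]
    exact Matrix.rank_mul_le_left W Wᵀ
  refine IsGreatest.csSup_eq ⟨⟨W, hW, hWr⟩, ?_⟩
  rintro _ ⟨M, hM, rfl⟩
  exact hub M hM

/-- Matrices supported on `P` correspond to functions on the positions satisfying `P`. -/
def zeroOutsideEquiv {𝔽 : Type*} [Field 𝔽] {n m : ℕ} (P : Fin n → Fin m → Prop)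
    [∀ i j, Decidable (P i j)] :
    zeroOutside (𝔽 := 𝔽) P ≃ₗ[𝔽] ({p : Fin n × Fin m // P p.1 p.2} → 𝔽) where
  toFun M p := M.1 p.1.1 p.1.2
  invFun g := ⟨Matrix.of fun i j => if h : P i j then g ⟨(i, j), h⟩ else 0, by
    intro i j h
    simp [h]⟩
  map_add' _ _ := rfl
  map_smul' _ _ := rfl
  left_inv M := by
    ext i j
    by_cases h : P i j
    · simp [h]
    · simp [h, M.2 i j h]
  right_inv g := by
    ext ⟨p, hp⟩
    simp [hp]

theorem finrank_zeroOutside_s4 {𝔽 : Type*} [Field 𝔽] {n m : ℕ} (P : Fin n → Fin m → Prop)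
    [∀ i j, Decidable (P i j)] :
    Module.finrank 𝔽 (zeroOutside (𝔽 := 𝔽) P) =
      Fintype.card {p : Fin n × Fin m // P p.1 p.2} := by
  rw [(zeroOutsideEquiv P).finrank_eq, Module.finrank_fintype_fun_eq_card]

/-- The dual of a coordinate code is the coordinate code on the complementary positions. -/
theorem dualCode_zeroOutside {𝔽 : Type*} [Field 𝔽] {n m : ℕ} (P : Fin n → Fin m → Prop) :
    dualCode (zeroOutside (𝔽 := 𝔽) P) = zeroOutside fun i j => ¬ P i j := by
  classical
  have htr : ∀ M N : Matrix (Fin n) (Fin m) 𝔽,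
      Matrix.trace (M * Nᵀ) = ∑ i, ∑ j, M i j * N i j := fun M N => by
    simp [Matrix.trace, Matrix.mul_apply]
  ext M
  constructor
  · intro hM i j hij
    have hij : P i j := not_not.mp hij
    have hN : Matrix.single i j (1 : 𝔽) ∈ zeroOutside (𝔽 := 𝔽) P := by
      intro a b hab
      refine Matrix.single_apply_of_ne _ _ _ _ _ ?_
      rintro ⟨rfl, rfl⟩
      exact hab hij
    have := hM _ hN
    rw [htr, Finset.sum_eq_single i, Finset.sum_eq_single j] at this
    · simpa using this
    · intro b _ hb
      simp [hb.symm]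
    · simp
    · intro a _ ha
      simp [ha.symm]
    · simp
  · intro hM N hN
    rw [htr]
    refine Finset.sum_eq_zero fun i _ => Finset.sum_eq_zero fun j _ => ?_
    by_cases h : P i j
    · rw [hM i j (not_not.mpr h), zero_mul]
    · rw [hN i j h, mul_zero]

theorem isQOAC_of_finrank_eq {𝔽 : Type*} [Field 𝔽] {n m k r : ℕ}
    {C : Submodule 𝔽 (Matrix (Fin n) (Fin m) 𝔽)} (hr : 0 < r) (hrm : r < m)
    (hdim : Module.finrank 𝔽 C = k * m + r) (hmax : maxrk C = k + 1) : isQOAC C := by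
  have hm : (0 : ℚ) < m := by exact_mod_cast hr.trans hrm
  have hr' : (0 : ℚ) < r := by exact_mod_cast hr
  have hrm' : (r : ℚ) < m := by exact_mod_cast hrm
  refine ⟨?_, ?_⟩
  · rw [hdim, Nat.dvd_add_right (Dvd.intro_left k rfl)]
    exact Nat.not_dvd_of_pos_of_lt hr hrm
  · rw [hdim, hmax, eq_comm, Int.ceil_eq_iff]
    push_cast
    constructor
    · rw [lt_div_iff₀ hm]
      linarith
    · rw [div_le_iff₀ hm]
      linarith

theorem card_rows_then_partial_row {n m α ρ : ℕ} (hα : α < n) (hρ : ρ ≤ m) :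
    Fintype.card {p : Fin n × Fin m //
      (p.1 : ℕ) < α ∨ ((p.1 : ℕ) = α ∧ (p.2 : ℕ) < ρ)} = α * m + ρ := by
  have e : {p : Fin n × Fin m // (p.1 : ℕ) < α ∨ ((p.1 : ℕ) = α ∧ (p.2 : ℕ) < ρ)} ≃
      (Fin α × Fin m) ⊕ Fin ρ :=
    { toFun := fun p => if h : (p.1.1 : ℕ) < α then Sum.inl (⟨p.1.1, h⟩, p.1.2)
        else Sum.inr ⟨p.1.2, by have := p.2; omega⟩
      invFun := Sum.elim
        (fun x => ⟨(⟨x.1, x.1.2.trans hα⟩, x.2), Or.inl x.1.2⟩)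
        (fun y => ⟨(⟨α, hα⟩, ⟨y, y.2.trans_le hρ⟩), Or.inr ⟨rfl, y.2⟩⟩)
      left_inv := by
        rintro ⟨⟨i, j⟩, hp⟩
        by_cases h : (i : ℕ) < α
        · simp [h]
        · have hi : (i : ℕ) = α := by simp only at hp; omega
          simp [hi, Fin.ext_iff]
      right_inv := by
        rintro (x | y) <;> simp }
  simp [Fintype.card_congr e]


/-- The code with first `α` rows arbitrary, row `α+1` arbitrary in the first
`ρ` entries and zero in the last `m−ρ`, and remaining rows zero, has dimension `αm + ρ`,
maximum rank `α+1`, dual maximum rank `n−α`, and is a dually qOAC. -/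
theorem stmt4 {𝔽 : Type*} [Field 𝔽] [Fintype 𝔽] {n m α ρ : ℕ}
    (hα : α < n) (hnm : n ≤ m) (hρ0 : 0 < ρ) (hρm : ρ < m)
    (C : Submodule 𝔽 (Matrix (Fin n) (Fin m) 𝔽))
    (hC : C = zeroOutside (fun (i : Fin n) (j : Fin m) =>
        (i : ℕ) < α ∨ ((i : ℕ) = α ∧ (j : ℕ) < ρ))) :
    Module.finrank 𝔽 C = α * m + ρ ∧ maxrk C = α + 1 ∧ maxrk (dualCode C) = n - α ∧
      isDuallyQOAC C := by
  subst hC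
  have hdim : Module.finrank 𝔽 (zeroOutside (𝔽 := 𝔽) fun (i : Fin n) (j : Fin m) =>
      (i : ℕ) < α ∨ ((i : ℕ) = α ∧ (j : ℕ) < ρ)) = α * m + ρ := by
    rw [finrank_zeroOutside_s4, card_rows_then_partial_row hα hρm.le]
  have hmax : maxrk (zeroOutside (𝔽 := 𝔽) fun (i : Fin n) (j : Fin m) =>
      (i : ℕ) < α ∨ ((i : ℕ) = α ∧ (j : ℕ) < ρ)) = α + 1 := by
    rw [maxrk_zeroOutside _ (Finset.Iic ⟨α, hα⟩)
      (fun i => if h : (i : ℕ) < α then (⟨i + 1, by omega⟩ : Fin m) else ⟨0, by omega⟩)]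
    · simp
    · intro i j h
      simp only [Finset.mem_Iic, Fin.le_def]
      omega
    · intro i hi
      simp only [Finset.mem_Iic, Fin.le_def] at hi
      split_ifs with h
      · exact Or.inl h
      · exact Or.inr ⟨by omega, hρ0⟩
    · intro i hi k hk hik
      simp only [Finset.coe_Iic, Set.mem_Iic, Fin.le_def] at hi hk
      simp only at hik
      split_ifs at hik <;> simp only [Fin.ext_iff] at hik ⊢ <;> omega
  have hdimd : Module.finrank 𝔽 (dualCode (zeroOutside (𝔽 := 𝔽)
      fun (i : Fin n) (j : Fin m) =>
        (i : ℕ) < α ∨ ((i : ℕ) = α ∧ (j : ℕ) < ρ))) = (n - α - 1) * m + (m - ρ) := by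
    rw [dualCode_zeroOutside, finrank_zeroOutside_s4, Fintype.card_subtype_compl,
      card_rows_then_partial_row hα hρm.le, Fintype.card_prod, Fintype.card_fin,
      Fintype.card_fin]
    obtain ⟨k, rfl⟩ := Nat.exists_eq_add_of_lt hα
    have hk : α + k + 1 - α - 1 = k := by omega
    rw [hk, add_mul, add_mul]
    omega
  have hmaxd : maxrk (dualCode (zeroOutside (𝔽 := 𝔽) fun (i : Fin n) (j : Fin m) =>
      (i : ℕ) < α ∨ ((i : ℕ) = α ∧ (j : ℕ) < ρ))) = n - α := by
    rw [dualCode_zeroOutside, maxrk_zeroOutside _ (Finset.Ici ⟨α, hα⟩)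
      (fun i => if α < (i : ℕ) then (⟨i - 1, by omega⟩ : Fin m) else ⟨m - 1, by omega⟩)]
    · simp
    · intro i j h
      simp only [Finset.mem_Ici, Fin.le_def]
      omega
    · intro i hi
      simp only [Finset.mem_Ici, Fin.le_def] at hi
      split_ifs with h <;> simp only <;> omega
    · intro i hi k hk hik
      simp only [Finset.coe_Ici, Set.mem_Ici, Fin.le_def] at hi hk
      simp only at hik
      split_ifs at hik <;> simp only [Fin.ext_iff] at hik ⊢ <;> omega
  exact ⟨hdim, hmax, hmaxd, isQOAC_of_finrank_eq hρ0 hρm hdim hmax,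
    isQOAC_of_finrank_eq (by omega) (by omega) hdimd (by omega)⟩
end
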